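/- arXiv:2404.18641 — 10 statements merged into one kernel-verified Lean document; each statement's English description precedes it below -/
import Mathlib

section
/- H(gl(1,1)) is not finitely generated as a module over its center Z(H(gl(1,1))). -/
open FreeAlgebra

noncomputable section

/-- The defining relations of the bosonization `H(gl(1,1))`: generators
`x = ι 0`, `y = ι 1`, `u = ι 2`, `v = ι 3`, `t = ι 4`. -/
inductive Hrel : FreeAlgebra ℂ (Fin 5) → FreeAlgebra ℂ (Fin 5) → Prop
  | xy : Hrel (ι ℂ 0 * ι ℂ 1) (ι ℂ 1 * ι ℂ 0)
  | xu : Hrel (ι ℂ 0 * ι ℂ 2) (ι ℂ 2 * ι ℂ 0)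
  | xv : Hrel (ι ℂ 0 * ι ℂ 3) (ι ℂ 3 * ι ℂ 0)
  | yu : Hrel (ι ℂ 1 * ι ℂ 2 - ι ℂ 2 * ι ℂ 1) (ι ℂ 2)
  | yv : Hrel (ι ℂ 1 * ι ℂ 3 - ι ℂ 3 * ι ℂ 1) (-ι ℂ 3)
  | uu : Hrel (ι ℂ 2 * ι ℂ 2) 0
  | vv : Hrel (ι ℂ 3 * ι ℂ 3) 0
  | uv : Hrel (ι ℂ 2 * ι ℂ 3 + ι ℂ 3 * ι ℂ 2) (ι ℂ 0)
  | tt : Hrel (ι ℂ 4 * ι ℂ 4) 1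
  | tx : Hrel (ι ℂ 4 * ι ℂ 0) (ι ℂ 0 * ι ℂ 4)
  | ty : Hrel (ι ℂ 4 * ι ℂ 1) (ι ℂ 1 * ι ℂ 4)
  | tu : Hrel (ι ℂ 4 * ι ℂ 2) (-(ι ℂ 2 * ι ℂ 4))
  | tv : Hrel (ι ℂ 4 * ι ℂ 3) (-(ι ℂ 3 * ι ℂ 4))

/-- The bosonization `H(gl(1,1))`, i.e. the free algebra modulo the two-sided
ideal generated by the relations. -/
abbrev Hgl : Type := RingQuot Hrel

/-- The image of the generator `x` in `H(gl(1,1))`. -/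
def hx : Hgl := RingQuot.mkAlgHom ℂ Hrel (ι ℂ 0)
/-- The image of the generator `y` in `H(gl(1,1))`. -/
def hy : Hgl := RingQuot.mkAlgHom ℂ Hrel (ι ℂ 1)
/-- The image of the generator `u` in `H(gl(1,1))`. -/
def hu : Hgl := RingQuot.mkAlgHom ℂ Hrel (ι ℂ 2)
/-- The image of the generator `v` in `H(gl(1,1))`. -/
def hv : Hgl := RingQuot.mkAlgHom ℂ Hrel (ι ℂ 3)
/-- The image of the generator `t` in `H(gl(1,1))`. -/
def ht : Hgl := RingQuot.mkAlgHom ℂ Hrel (ι ℂ 4)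

open Polynomial

/-- The character of `H(gl(1,1))` over `ℂ[X]` with `x, u, v ↦ 0`, `y ↦ X`, `t ↦ s`. -/
def character (s : ℂ) (hs : s * s = 1) : Hgl →ₐ[ℂ] ℂ[X] :=
  RingQuot.liftAlgHom ℂ ⟨FreeAlgebra.lift ℂ ![0, X, 0, 0, C s], by
    have hC : (C s * C s : ℂ[X]) = 1 := by rw [← C_mul, hs, C_1]
    intro a b h
    cases h <;> simp only [map_mul, map_add, map_sub, map_neg, map_zero, map_one,
      FreeAlgebra.lift_ι_apply, Matrix.cons_val]
    all_goals first | exact hC | ring⟩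

/-- The representation of `H(gl(1,1))` on `ℂ[X]²` with `x, v ↦ 0`, `y ↦ diag(X, X - 1)`,
`t ↦ diag(s, -s)` and `u` the elementary matrix `E₁₂`. -/
def triangularRep (s : ℂ) (hs : s * s = 1) : Hgl →ₐ[ℂ] Matrix (Fin 2) (Fin 2) ℂ[X] :=
  RingQuot.liftAlgHom ℂ ⟨FreeAlgebra.lift ℂ
      ![0, !![X, 0; 0, X - 1], !![0, 1; 0, 0], 0, !![C s, 0; 0, -C s]], by
    have hC : (C s * C s : ℂ[X]) = 1 := by rw [← C_mul, hs, C_1]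
    intro a b h
    cases h <;> simp only [map_mul, map_add, map_sub, map_neg, map_zero, map_one,
      FreeAlgebra.lift_ι_apply, Matrix.cons_val]
    case uu => simp [← Matrix.ext_iff, Fin.forall_fin_two]
    case tt => simpa [Matrix.one_fin_two] using hC
    case ty => simpa using mul_comm _ _
    all_goals simp⟩

theorem triangularRep_entries (s : ℂ) (hs : s * s = 1) (hs' : -s * -s = 1) (a : Hgl) :
    triangularRep s hs a 0 0 = character s hs a ∧
      triangularRep s hs a 1 1 = (character (-s) hs' a).comp (X - 1) ∧
      triangularRep s hs a 1 0 = 0 := by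
  obtain ⟨a, rfl⟩ := RingQuot.mkAlgHom_surjective ℂ Hrel a
  induction a using FreeAlgebra.induction with
  | grade0 r => simp [Matrix.algebraMap_matrix_apply]
  | grade1 i =>
    revert i
    simp [Fin.forall_fin_succ, triangularRep, character]
  | mul a b ha hb => simp_all [Matrix.mul_apply]
  | add a b ha hb => simp_all

theorem character_center_shift (s : ℂ) (hs : s * s = 1) (hs' : -s * -s = 1) {z : Hgl}
    (hz : z ∈ Subring.center Hgl) :
    character s hs z = (character (-s) hs' z).comp (X - 1) := by
  obtain ⟨h₀, h₁, -⟩ := triangularRep_entries s hs hs' z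
  have hu_val : triangularRep s hs hu = !![0, 1; 0, 0] := by
    simp [triangularRep, hu]
  have h := congrArg (triangularRep s hs) (Subring.mem_center_iff.mp hz hu)
  rw [map_mul, map_mul, hu_val] at h
  have h01 := congrFun (congrFun h 0) 1
  rw [← h₀, ← h₁]
  simpa [Matrix.mul_apply] using h01.symm

theorem eq_C_of_comp_sub_two {p : ℂ[X]} (h : p = (p.comp (X - 1)).comp (X - 1)) :
    p = C (p.eval 0) := by
  have heval (n : ℕ) : p.eval (2 * n : ℂ) = p.eval 0 := by
    induction n with
    | zero => simp
    | succ n ih =>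
      rw [← ih]
      nth_rewrite 1 [h]
      simp only [eval_comp, eval_sub, eval_X, eval_one]
      congr 1
      push_cast
      ring
  refine Polynomial.eq_of_infinite_eval_eq _ _
    ((Set.infinite_range_of_injective (f := fun n : ℕ => (2 * n : ℂ)) ?_).mono ?_)
  · intro m n hmn
    simpa using hmn
  · rintro _ ⟨n, rfl⟩
    simpa using heval n

theorem character_one_center {z : Hgl} (hz : z ∈ Subring.center Hgl) :
    ∃ c : ℂ, character 1 (by norm_num) z = C c := by
  refine ⟨_, eq_C_of_comp_sub_two ?_⟩
  have h₁ := character_center_shift 1 (by norm_num) (by norm_num) hz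
  have h₂ := character_center_shift (-1) (by norm_num) (by norm_num) hz
  simp only [neg_neg] at h₂
  rw [← h₂, ← h₁]

theorem character_surjective (s : ℂ) (hs : s * s = 1) :
    Function.Surjective (character s hs) := by
  intro p
  refine ⟨aeval hy p, ?_⟩
  have : character s hs hy = X := by simp [character, hy]
  rw [← aeval_algHom_apply, this, aeval_X_left_apply]

/-- `H(gl(1,1))` is not finitely generated as a module over its center. -/
theorem stmt_0 : ¬ Module.Finite (Subring.center Hgl) Hgl := by
  rintro ⟨S, hS⟩
  refine Polynomial.not_finite (R := ℂ) ⟨⟨S.image (character 1 (by norm_num)), ?_⟩⟩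
  rw [eq_top_iff]
  rintro p -
  obtain ⟨a, rfl⟩ := character_surjective 1 (by norm_num) p
  have ha : a ∈ Submodule.span (Subring.center Hgl) (S : Set Hgl) := hS ▸ Submodule.mem_top
  induction ha using Submodule.span_induction with
  | mem a ha => exact Submodule.subset_span (by simpa using ⟨a, ha, rfl⟩)
  | zero => simp
  | add a b _ _ ha hb => rw [map_add]; exact add_mem ha hb
  | smul z a _ ha =>
    obtain ⟨c, hc⟩ := character_one_center z.2
    rw [Subring.smul_def, smul_eq_mul, map_mul, hc, ← smul_eq_C_mul]
    exact Submodule.smul_mem _ _ ha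
end
end

section
/- H(gl(1,1)) is a semiprime ring. -/
open FreeAlgebra

noncomputable section

open Polynomial

section

/-- The ring structure of `H(gl(1,1))`, declared on its own so that the lemmas on negation
unify with it. -/
local instance instRingHgl : Ring Hgl := RingQuot.instRing Hrel

theorem hx_mul_hy : hx * hy = hy * hx := by
  simpa [hx, hy] using RingQuot.mkAlgHom_rel ℂ Hrel.xy

theorem hx_mul_hu : hx * hu = hu * hx := by
  simpa [hx, hu] using RingQuot.mkAlgHom_rel ℂ Hrel.xu

theorem hx_mul_hv : hx * hv = hv * hx := by
  simpa [hx, hv] using RingQuot.mkAlgHom_rel ℂ Hrel.xv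

theorem hy_mul_hu_sub : hy * hu - hu * hy = hu := by
  simpa [hy, hu] using RingQuot.mkAlgHom_rel ℂ Hrel.yu

theorem hy_mul_hv_sub : hy * hv - hv * hy = -hv := by
  simpa [hy, hv] using RingQuot.mkAlgHom_rel ℂ Hrel.yv

theorem hu_mul_hu : hu * hu = 0 := by
  simpa [hu] using RingQuot.mkAlgHom_rel ℂ Hrel.uu

theorem hv_mul_hv : hv * hv = 0 := by
  simpa [hv] using RingQuot.mkAlgHom_rel ℂ Hrel.vv

theorem hu_mul_hv_add : hu * hv + hv * hu = hx := by
  simpa [hu, hv, hx] using RingQuot.mkAlgHom_rel ℂ Hrel.uv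

theorem ht_mul_ht : ht * ht = 1 := by
  simpa [ht] using RingQuot.mkAlgHom_rel ℂ Hrel.tt

theorem ht_mul_hx : ht * hx = hx * ht := by
  simpa [hx, ht] using RingQuot.mkAlgHom_rel ℂ Hrel.tx

theorem ht_mul_hy : ht * hy = hy * ht := by
  simpa [hy, ht] using RingQuot.mkAlgHom_rel ℂ Hrel.ty

theorem ht_mul_hu : ht * hu = -(hu * ht) := by
  simpa [hu, ht] using RingQuot.mkAlgHom_rel ℂ Hrel.tu

theorem ht_mul_hv : ht * hv = -(hv * ht) := by
  simpa [hv, ht] using RingQuot.mkAlgHom_rel ℂ Hrel.tv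

theorem commute_aeval_hx {w : Hgl} (hw : Commute hx w) (q : ℂ[X]) :
    Commute (aeval hx q) w := by
  induction q using Polynomial.induction_on' with
  | add p q hp hq => simpa using hp.add_left hq
  | monomial n a =>
    rw [aeval_monomial]
    exact Commute.mul_left (Algebra.commutes a w) (hw.pow_left n)

/-- Evaluation of a polynomial in two variables at the commuting elements `x`, `y`. -/
def evalXY : ℂ[X][X] →+* Hgl :=
  eval₂RingHom' (aeval hx : ℂ[X] →ₐ[ℂ] Hgl).toRingHom hy (commute_aeval_hx hx_mul_hy)

@[simp] theorem evalXY_X : evalXY X = hy := by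
  simp [evalXY, eval₂RingHom']

@[simp] theorem evalXY_C (q : ℂ[X]) : evalXY (C q) = aeval hx q := by
  simp [evalXY, eval₂RingHom']

theorem mul_evalXY {w : Hgl} {c : ℂ[X]} (hwx : Commute hx w)
    (hwy : w * hy = (hy + aeval hx c) * w) (p : ℂ[X][X]) :
    w * evalXY p = evalXY (p.comp (X + C c)) * w := by
  induction p using Polynomial.induction_on with
  | C a => simpa using (commute_aeval_hx hwx a).symm.eq
  | add p q hp hq => simp [mul_add, add_mul, hp, hq]
  | monomial n a ih =>
    rw [pow_succ, ← mul_assoc, map_mul, ← mul_assoc, ih, mul_assoc, evalXY_X, hwy,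
      mul_comp _ X, X_comp, map_mul, map_add, evalXY_X, evalXY_C, mul_assoc]

theorem hu_mul_evalXY (p : ℂ[X][X]) : hu * evalXY p = evalXY (p.comp (X + C (-1))) * hu := by
  refine mul_evalXY hx_mul_hu ?_ p
  rw [map_neg, map_one, add_mul, neg_one_mul, sub_eq_iff_eq_add.1 hy_mul_hu_sub]
  abel

theorem hv_mul_evalXY (p : ℂ[X][X]) : hv * evalXY p = evalXY (p.comp (X + C 1)) * hv := by
  refine mul_evalXY hx_mul_hv ?_ p
  rw [map_one, add_mul, one_mul, sub_eq_iff_eq_add.1 hy_mul_hv_sub]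
  abel

theorem ht_mul_evalXY (p : ℂ[X][X]) : ht * evalXY p = evalXY p * ht := by
  simpa using mul_evalXY (c := 0) (w := ht) ht_mul_hx.symm (by simpa using ht_mul_hy) p

/-- The element `p + q u + r v + s u v` with coefficients polynomials in `x`, `y`. -/
def evenForm (p q r s : ℂ[X][X]) : Hgl :=
  evalXY p + evalXY q * hu + evalXY r * hv + evalXY s * (hu * hv)

theorem evalXY_mul_evenForm (f p q r s : ℂ[X][X]) :
    evalXY f * evenForm p q r s = evenForm (f * p) (f * q) (f * r) (f * s) := by
  simp only [evenForm, map_mul, mul_add, mul_assoc]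

theorem hu_mul_evenForm (p q r s : ℂ[X][X]) :
    hu * evenForm p q r s =
      evenForm 0 (p.comp (X + C (-1))) 0 (r.comp (X + C (-1))) := by
  simp only [evenForm, mul_add, ← mul_assoc, hu_mul_evalXY]
  simp only [mul_assoc, hu_mul_hu]
  simp

theorem hv_mul_hu : hv * hu = hx - hu * hv := eq_sub_of_add_eq' hu_mul_hv_add

theorem hv_mul_evenForm (p q r s : ℂ[X][X]) :
    hv * evenForm p q r s =
      evenForm (q.comp (X + C 1) * C X) 0 (p.comp (X + C 1) + s.comp (X + C 1) * C X)
        (-q.comp (X + C 1)) := by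
  simp only [evenForm, mul_add, ← mul_assoc, hv_mul_evalXY]
  simp only [mul_assoc, hv_mul_hv, hv_mul_hu, map_add, map_mul, map_neg, evalXY_C, aeval_X,
    map_zero, sub_mul, mul_sub, add_mul, neg_mul, mul_zero, zero_mul]
  abel

theorem ht_mul_evenForm (p q r s : ℂ[X][X]) :
    ht * evenForm p q r s = evenForm p (-q) (-r) s * ht := by
  simp only [evenForm, mul_add, ← mul_assoc, ht_mul_evalXY]
  simp [add_mul, mul_assoc, ht_mul_hu, ht_mul_hv]

theorem exists_mul_eq_evenForm (a : Hgl) (p q r s p' q' r' s' : ℂ[X][X]) :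
    ∃ f g h k f' g' h' k' : ℂ[X][X],
      a * (evenForm p q r s + evenForm p' q' r' s' * ht) =
        evenForm f g h k + evenForm f' g' h' k' * ht := by
  obtain ⟨a, rfl⟩ := RingQuot.mkAlgHom_surjective ℂ Hrel a
  induction a using FreeAlgebra.induction generalizing p q r s p' q' r' s' with
  | grade0 c =>
    rw [AlgHom.commutes, show algebraMap ℂ Hgl c = evalXY (C (C c)) by simp, mul_add, ← mul_assoc,
      evalXY_mul_evenForm, evalXY_mul_evenForm]
    exact ⟨_, _, _, _, _, _, _, _, rfl⟩
  | grade1 i =>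
    fin_cases i
    · change ∃ f g h k f' g' h' k' : ℂ[X][X], hx * _ = _
      rw [show hx = evalXY (C X) by simp, mul_add, ← mul_assoc,
        evalXY_mul_evenForm, evalXY_mul_evenForm]
      exact ⟨_, _, _, _, _, _, _, _, rfl⟩
    · change ∃ f g h k f' g' h' k' : ℂ[X][X], hy * _ = _
      rw [← evalXY_X, mul_add, ← mul_assoc, evalXY_mul_evenForm, evalXY_mul_evenForm]
      exact ⟨_, _, _, _, _, _, _, _, rfl⟩
    · change ∃ f g h k f' g' h' k' : ℂ[X][X], hu * _ = _
      rw [mul_add, ← mul_assoc, hu_mul_evenForm, hu_mul_evenForm]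
      exact ⟨_, _, _, _, _, _, _, _, rfl⟩
    · change ∃ f g h k f' g' h' k' : ℂ[X][X], hv * _ = _
      rw [mul_add, ← mul_assoc, hv_mul_evenForm, hv_mul_evenForm]
      exact ⟨_, _, _, _, _, _, _, _, rfl⟩
    · change ∃ f g h k f' g' h' k' : ℂ[X][X], ht * _ = _
      rw [mul_add, ← mul_assoc, ht_mul_evenForm, ht_mul_evenForm, mul_assoc _ ht ht, ht_mul_ht,
        mul_one, add_comm]
      exact ⟨_, _, _, _, _, _, _, _, rfl⟩
  | mul a b ha hb =>
    obtain ⟨f, g, h, k, f', g', h', k', e⟩ := hb p q r s p' q' r' s'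
    rw [map_mul, mul_assoc, e]
    exact ha _ _ _ _ _ _ _ _
  | add a b ha hb =>
    obtain ⟨f, g, h, k, f', g', h', k', e⟩ := ha p q r s p' q' r' s'
    obtain ⟨m, n, o, l, m', n', o', l', e'⟩ := hb p q r s p' q' r' s'
    refine ⟨f + m, g + n, h + o, k + l, f' + m', g' + n', h' + o', k' + l', ?_⟩
    rw [map_add, add_mul, e, e']
    simp only [evenForm, map_add, add_mul]
    abel

theorem exists_eq_evenForm (a : Hgl) :
    ∃ p q r s p' q' r' s' : ℂ[X][X], a = evenForm p q r s + evenForm p' q' r' s' * ht := by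
  simpa [evenForm] using exists_mul_eq_evenForm a 1 0 0 0 0 0 0 0

/-- The images of the generators under the two-dimensional representation over `ℂ[x, z]`, in which
`y - z` acts as the idempotent `diag(1, 0)` and `t` as `diag(ε, -ε)`. -/
def repGen (ε : ℂ[X][X]) : Fin 5 → Matrix (Fin 2) (Fin 2) ℂ[X][X] :=
  ![!![C X, 0; 0, C X], !![X + 1, 0; 0, X], !![0, C X; 0, 0], !![0, 0; 1, 0], !![ε, 0; 0, -ε]]

theorem repGen_rel {ε : ℂ[X][X]} (hε : ε * ε = 1) {a b : FreeAlgebra ℂ (Fin 5)}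
    (h : Hrel a b) : FreeAlgebra.lift ℂ (repGen ε) a = FreeAlgebra.lift ℂ (repGen ε) b := by
  cases h <;>
    simp only [map_mul, map_add, map_sub, map_neg, map_zero, map_one, lift_ι_apply] <;>
    refine Matrix.ext fun i j => ?_ <;> fin_cases i <;> fin_cases j <;>
    simp [repGen, Matrix.mul_apply, Fin.sum_univ_two, hε] <;>
    first | ring1 | linear_combination hε

/-- The two-dimensional representation over `ℂ[x, z]` determined by a square root `ε` of `1`. -/
def rep (ε : ℂ[X][X]) (hε : ε * ε = 1) : Hgl →ₐ[ℂ] Matrix (Fin 2) (Fin 2) ℂ[X][X] :=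
  RingQuot.liftAlgHom ℂ ⟨FreeAlgebra.lift ℂ (repGen ε), fun _ _ h => repGen_rel hε h⟩

section rep

variable {ε : ℂ[X][X]} (hε : ε * ε = 1)

@[simp] theorem rep_hx : rep ε hε hx = !![C X, 0; 0, C X] := by
  simp [rep, hx, repGen]

@[simp] theorem rep_hy : rep ε hε hy = !![X + 1, 0; 0, X] := by
  simp [rep, hy, repGen]

@[simp] theorem rep_hu : rep ε hε hu = !![0, C X; 0, 0] := by
  simp [rep, hu, repGen]

@[simp] theorem rep_hv : rep ε hε hv = !![0, 0; 1, 0] := by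
  simp [rep, hv, repGen]

@[simp] theorem rep_ht : rep ε hε ht = !![ε, 0; 0, -ε] := by
  simp [rep, ht, repGen]

theorem rep_aeval_hx (q : ℂ[X]) : rep ε hε (aeval hx q) = !![C q, 0; 0, C q] := by
  induction q using Polynomial.induction_on with
  | C a =>
    rw [aeval_C, AlgHom.commutes]
    ext i j; fin_cases i <;> fin_cases j <;> simp [Matrix.algebraMap_matrix_apply]
  | add p q hp hq => simp [hp, hq]
  | monomial n a ih =>
    rw [pow_succ, ← mul_assoc, map_mul, map_mul, ih, aeval_X, rep_hx]
    simp

theorem rep_evalXY (p : ℂ[X][X]) : rep ε hε (evalXY p) = !![p.comp (X + 1), 0; 0, p] := by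
  induction p using Polynomial.induction_on with
  | C a => simp [rep_aeval_hx]
  | add p q hp hq => simp [hp, hq]
  | monomial n a ih =>
    rw [pow_succ, ← mul_assoc, map_mul, map_mul, ih, evalXY_X, rep_hy]
    simp

theorem rep_evenForm (p q r s : ℂ[X][X]) : rep ε hε (evenForm p q r s) =
    !![p.comp (X + 1) + s.comp (X + 1) * C X, q.comp (X + 1) * C X; r, p] := by
  simp [evenForm, rep_evalXY]

theorem rep_eq_zero {a : Hgl} (ha : ∀ r : Hgl, a * r * a = 0) : rep ε hε a = 0 := by
  have h (r : Hgl) : rep ε hε a * rep ε hε r * rep ε hε a = 0 := by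
    rw [← map_mul, ← map_mul, ha, map_zero]
  have hu' := h hu
  have hv' := h hv
  have huv := h (hu * hv)
  have hvu := h (hv * hu)
  generalize rep ε hε a = M at *
  rw [M.eta_fin_two] at *
  simp [← Matrix.ext_iff, Fin.forall_fin_two] at *
  grind

end rep

theorem eq_zero_of_comp_X_add_one {p : ℂ[X][X]} (h : p.comp (X + 1) = 0) : p = 0 :=
  (taylor_eq_zero 1 p).1 (by simpa [taylor_apply] using h)

theorem eq_zero_of_add_of_add_mul_neg_one {p q : ℂ[X][X]} (h : p + q = 0)
    (h' : p + q * -1 = 0) : p = 0 ∧ q = 0 := by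
  have hp : 2 * p = 0 := by linear_combination h + h'
  have hq : 2 * q = 0 := by linear_combination h - h'
  exact ⟨by simpa using hp, by simpa using hq⟩

theorem eq_zero_of_rep_eq_zero {a : Hgl} (h₁ : rep 1 (by simp) a = 0)
    (h₂ : rep (-1) (by ring) a = 0) : a = 0 := by
  obtain ⟨p, q, r, s, p', q', r', s', rfl⟩ := exists_eq_evenForm a
  simp [rep_evenForm, ← Matrix.ext_iff, Fin.forall_fin_two] at h₁ h₂
  obtain ⟨⟨hs₁, hq₁⟩, hr₁, hp₁⟩ := h₁
  obtain ⟨⟨hs₂, hq₂⟩, hr₂, hp₂⟩ := h₂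
  obtain ⟨rfl, rfl⟩ := eq_zero_of_add_of_add_mul_neg_one hp₂ hp₁
  obtain ⟨rfl, rfl⟩ := eq_zero_of_add_of_add_mul_neg_one hr₁ hr₂
  obtain ⟨hq, hq'⟩ := eq_zero_of_add_of_add_mul_neg_one hq₂ hq₁
  obtain ⟨hs, hs'⟩ := eq_zero_of_add_of_add_mul_neg_one hs₁ hs₂
  simp only [zero_comp, zero_add, mul_eq_zero, C_eq_zero, X_ne_zero, or_false] at hq hq' hs hs'
  simp [evenForm, eq_zero_of_comp_X_add_one hq, eq_zero_of_comp_X_add_one hq',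
    eq_zero_of_comp_X_add_one hs, eq_zero_of_comp_X_add_one hs']

end

/-- `H(gl(1,1))` is a semiprime ring. -/
theorem stmt_1 : ∀ a : Hgl, (∀ r : Hgl, a * r * a = 0) → a = 0 :=
  fun _ ha => eq_zero_of_rep_eq_zero (rep_eq_zero _ ha) (rep_eq_zero _ ha)
end
end

section
/- In H(gl(1,1)), let w := −x + 2uv. Then w² = x², and consequently (x − wt)(x + wt) = 0. -/
open FreeAlgebra

noncomputable section

/-- If `x = uv + vu` commutes with `u` and `v`, and `v² = 0`, then `(-x + 2uv)² = x²`. -/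
theorem sq_neg_add_two_mul_eq {R : Type*} [Ring R] {x u v : R} (xu : x * u = u * x)
    (xv : x * v = v * x) (vv : v * v = 0) (uv : u * v + v * u = x) :
    (-x + 2 * u * v) * (-x + 2 * u * v) = x * x := by
  have h : u * v * (u * v) = x * (u * v) := by
    calc u * v * (u * v) = u * (u * v + v * u) * v - u * u * (v * v) := by noncomm_ring
      _ = x * (u * v) := by rw [uv, vv, mul_zero, sub_zero, ← xu, mul_assoc]
  have hc : u * v * x = x * (u * v) := by rw [mul_assoc, ← xv, ← mul_assoc, ← xu, mul_assoc]
  calc (-x + 2 * u * v) * (-x + 2 * u * v)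
      = x * x - 2 * (x * (u * v)) - 2 * (u * v * x) + 4 * (u * v * (u * v)) := by noncomm_ring
    _ = x * x := by rw [h, hc]; noncomm_ring

/-- If an involution `t` commutes with `x` and `w`, which commute with each other, and
`w² = x²`, then `(x - wt)(x + wt) = 0`. -/
theorem sub_mul_add_eq_zero_of_involution {R : Type*} [Ring R] {x w t : R}
    (xw : x * w = w * x) (tx : t * x = x * t) (tw : t * w = w * t) (tt : t * t = 1)
    (ww : w * w = x * x) : (x - w * t) * (x + w * t) = 0 := by
  calc (x - w * t) * (x + w * t)
      = x * x + x * w * t - w * (t * x) - w * (t * w) * t := by noncomm_ring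
    _ = x * x + w * x * t - w * x * t - w * w * (t * t) := by rw [xw, tx, tw]; noncomm_ring
    _ = 0 := by rw [tt, ww]; noncomm_ring

/-- An element anticommuting with two factors commutes with their product. -/
theorem commute_mul_of_anticommute {R : Type*} [Ring R] {t u v : R}
    (tu : t * u = -(u * t)) (tv : t * v = -(v * t)) : Commute t (u * v) := by
  change t * (u * v) = u * v * t
  rw [← mul_assoc, tu, neg_mul, mul_assoc, tv, mul_neg, neg_neg, mul_assoc]

/-- For `w = -x + 2uv` in `H(gl(1,1))`: `w² = x²` and `(x - wt)(x + wt) = 0`. -/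
theorem stmt_4 :
    let w : Hgl := -hx + 2 * hu * hv
    w * w = hx * hx ∧ (hx - w * ht) * (hx + w * ht) = 0 := by
  have xu : hx * hu = hu * hx := by
    simpa [hx, hu] using RingQuot.mkAlgHom_rel ℂ Hrel.xu
  have xv : hx * hv = hv * hx := by
    simpa [hx, hv] using RingQuot.mkAlgHom_rel ℂ Hrel.xv
  have vv : hv * hv = 0 := by
    simpa [hv] using RingQuot.mkAlgHom_rel ℂ Hrel.vv
  have uv : hu * hv + hv * hu = hx := by
    simpa [hx, hu, hv] using RingQuot.mkAlgHom_rel ℂ Hrel.uv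
  have tt : ht * ht = 1 := by
    simpa [ht] using RingQuot.mkAlgHom_rel ℂ Hrel.tt
  have tx : ht * hx = hx * ht := by
    simpa [ht, hx] using RingQuot.mkAlgHom_rel ℂ Hrel.tx
  have tu : ht * hu = -(hu * ht) := by
    simpa [ht, hu] using RingQuot.mkAlgHom_rel ℂ Hrel.tu
  have tv : ht * hv = -(hv * ht) := by
    simpa [ht, hv] using RingQuot.mkAlgHom_rel ℂ Hrel.tv
  have ww := sq_neg_add_two_mul_eq xu xv vv uv
  have xuv : Commute hx (hu * hv) := Commute.mul_right xu xv
  have tuv : Commute ht (hu * hv) := commute_mul_of_anticommute tu tv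
  refine ⟨ww, sub_mul_add_eq_zero_of_involution ?_ tx ?_ tt ww⟩
  · rw [mul_assoc]
    exact ((Commute.refl hx).neg_right.add_right ((Commute.ofNat_right hx 2).mul_right xuv))
  · rw [mul_assoc]
    exact (Commute.neg_right tx).add_right ((Commute.ofNat_right ht 2).mul_right tuv)
end
end

section
/- H(gl(1,1)) satisfies a polynomial identity; more precisely, there exists a positive integer N such that the standard identity of degree N holds in H(gl(1,1)): for all a₁, …, a_N ∈ H(gl(1,1)), Σ_{σ ∈ S_N} sgn(σ)·a_{σ(1)}·a_{σ(2)}···a_{σ(N)} = 0. -/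
open FreeAlgebra

noncomputable section

/-- The standard identity of degree `N` holds in the ring `R`. -/
def SatisfiesStandardIdentity (N : ℕ) (R : Type*) [Ring R] : Prop :=
  ∀ a : Fin N → R,
    ∑ σ : Equiv.Perm (Fin N),
      (Equiv.Perm.sign σ : ℤ) • (List.ofFn fun i => a (σ i)).prod = 0

namespace SatisfiesStandardIdentity

variable {N : ℕ} {R S : Type*} [Ring R] [Ring S]

theorem map_sum_sign_smul_prod (f : R →+* S) (a : Fin N → R) :
    f (∑ σ : Equiv.Perm (Fin N),
      (Equiv.Perm.sign σ : ℤ) • (List.ofFn fun i => a (σ i)).prod) =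
    ∑ σ : Equiv.Perm (Fin N),
      (Equiv.Perm.sign σ : ℤ) • (List.ofFn fun i => f (a (σ i))).prod := by
  simp only [map_sum, map_zsmul, map_list_prod, List.map_ofFn, Function.comp_def]

theorem of_injective (f : R →+* S) (hf : Function.Injective f)
    (h : SatisfiesStandardIdentity N S) : SatisfiesStandardIdentity N R := fun a =>
  hf <| by rw [map_sum_sign_smul_prod, map_zero]; exact h fun i => f (a i)

theorem of_surjective (f : R →+* S) (hf : Function.Surjective f)
    (h : SatisfiesStandardIdentity N R) : SatisfiesStandardIdentity N S := fun a => by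
  choose g hg using hf
  have key := (map_sum_sign_smul_prod f fun i => g (a i)).symm.trans
    ((congrArg f (h fun i => g (a i))).trans (map_zero f))
  simpa only [hg] using key

theorem of_mulOpposite (h : SatisfiesStandardIdentity N Rᵐᵒᵖ) :
    SatisfiesStandardIdentity N R := fun a => by
  have key := congrArg MulOpposite.unop (h fun i => MulOpposite.op (a i))
  have hrev (σ : Equiv.Perm (Fin N)) :
      (List.ofFn fun i => MulOpposite.op (a (σ i))).prod =
        MulOpposite.op
          (List.ofFn fun i => a ((σ * (Fin.revPerm : Equiv.Perm (Fin N))) i)).prod := by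
    rw [MulOpposite.op_list_prod, List.map_ofFn]
    congr 1
    refine List.ext_getElem (by simp) fun i hi _ => ?_
    simp only [List.getElem_reverse, List.getElem_ofFn, List.length_ofFn, Function.comp_apply,
      Equiv.Perm.mul_apply, Fin.revPerm_apply]
    congr 3
    ext
    rw [List.length_ofFn] at hi
    simp only [Fin.val_rev]
    omega
  simp only [hrev, ← MulOpposite.op_smul, ← Finset.op_sum, MulOpposite.unop_op,
    MulOpposite.unop_zero] at key
  rw [← Equiv.sum_comp (Equiv.mulRight (Fin.revPerm : Equiv.Perm (Fin N)))]
  simp only [Equiv.coe_mulRight, Equiv.Perm.sign_mul, Units.val_mul,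
    mul_comm _ ((Equiv.Perm.sign (Fin.revPerm : Equiv.Perm (Fin N)) : ℤˣ) : ℤ), mul_smul,
    ← Finset.smul_sum]
  rw [key, smul_zero]

/-- Matrices of size `ι` over a commutative ring satisfy every standard identity of degree
larger than the rank `(card ι) ^ 2`. -/
theorem matrix {A ι : Type*} [CommRing A] [Fintype ι] [DecidableEq ι]
    (hN : Fintype.card (ι × ι) < N) : SatisfiesStandardIdentity N (Matrix ι ι A) := fun a => by
  have h : MultilinearMap.alternatization
      (MultilinearMap.mkPiAlgebraFin A N (Matrix ι ι A)) = 0 :=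
    (Matrix.stdBasis A ι ι).ext_alternating fun v hv => by
      have := Fintype.card_le_of_injective v hv
      rw [Fintype.card_fin] at this
      omega
  simpa [MultilinearMap.alternatization_apply, Units.smul_def] using DFunLike.congr_fun h a

/-- A ring that is a finite left module over a commutative ring `A`, such that right
multiplications are `A`-linear, satisfies a standard identity. -/
theorem exists_of_finite (A R : Type*) [CommRing A] [Ring R] [Module A R] [IsScalarTower A R R]
    [Module.Finite A R] : ∃ N, 0 < N ∧ SatisfiesStandardIdentity N R := by
  obtain ⟨n, b, hb⟩ := Module.Finite.exists_fin (R := A) (M := R)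
  refine ⟨Fintype.card (Fin n × Fin n) + 1, Nat.succ_pos _, of_mulOpposite ?_⟩
  have hend : SatisfiesStandardIdentity (Fintype.card (Fin n × Fin n) + 1) (Module.End A R) :=
    of_surjective (Matrix.isRepresentation.toEnd A b hb).toRingHom
      (Matrix.isRepresentation.toEnd_surjective A b hb)
      (of_injective (Matrix.isRepresentation A b).val.toRingHom Subtype.val_injective
        (matrix (Nat.lt_succ_self _)))
  have : SMulCommClass Rᵐᵒᵖ A R := ⟨fun p r m => smul_mul_assoc r m p.unop⟩
  refine of_injective (Module.toModuleEnd A (S := Rᵐᵒᵖ) R) (fun p q hpq => ?_) hend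
  simpa using LinearMap.congr_fun hpq 1

end SatisfiesStandardIdentity

section Finiteness

variable {R : Type*} [Ring R] [Algebra ℂ R] {x y u v t : R}

/-- Under the defining relations of `H(gl(1,1))`, the monomials `uⁱ vʲ tᵏ` with
`i, j, k ≤ 1` span over the subalgebra generated by `x` and `y`. -/
theorem span_monomials_eq_top
    (xu : x * u = u * x) (xv : x * v = v * x)
    (yu : y * u - u * y = u) (yv : y * v - v * y = -v) (uu : u * u = 0) (vv : v * v = 0)
    (uv : u * v + v * u = x) (tt : t * t = 1) (tx : t * x = x * t) (ty : t * y = y * t)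
    (tu : t * u = -(u * t)) (tv : t * v = -(v * t))
    (hgen : Algebra.adjoin ℂ {x, y, u, v, t} = ⊤) :
    Submodule.span (Algebra.adjoin ℂ {x, y})
      ({1, u, v, u * v, t, u * t, v * t, u * (v * t)} : Set R) = ⊤ := by
  set A := Algebra.adjoin ℂ ({x, y} : Set R)
  set s : Set R := {1, u, v, u * v, t, u * t, v * t, u * (v * t)} with hs
  set M := Submodule.span A s
  have x_mul_mem {m : R} (hm : m ∈ M) : x * m ∈ M :=
    M.smul_mem (⟨x, Algebra.subset_adjoin (by simp)⟩ : A) hm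
  have y_mul_mem {m : R} (hm : m ∈ M) : y * m ∈ M :=
    M.smul_mem (⟨y, Algebra.subset_adjoin (by simp)⟩ : A) hm
  have h_one : (1 : R) ∈ M := Submodule.subset_span (by simp [hs])
  have h_u : u ∈ M := Submodule.subset_span (by simp [hs])
  have h_v : v ∈ M := Submodule.subset_span (by simp [hs])
  have h_uv : u * v ∈ M := Submodule.subset_span (by simp [hs])
  have h_t : t ∈ M := Submodule.subset_span (by simp [hs])
  have h_ut : u * t ∈ M := Submodule.subset_span (by simp [hs])
  have h_vt : v * t ∈ M := Submodule.subset_span (by simp [hs])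
  have h_uvt : u * (v * t) ∈ M := Submodule.subset_span (by simp [hs])
  have h_x : x ∈ M := by simpa using x_mul_mem h_one
  have h_y : y ∈ M := by simpa using y_mul_mem h_one
  have uy : u * y = y * u - u := eq_sub_of_add_eq (sub_eq_iff_eq_add'.mp yu).symm
  have vy : v * y = y * v + v := by rw [← sub_eq_iff_eq_add', ← neg_sub, yv, neg_neg]
  have vu : v * u = x - u * v := by rw [← uv]; abel
  have assoc {a b c : R} (h : a * b = c) (z : R) : a * (b * z) = c * z := by
    rw [← mul_assoc, h]
  have hstep : ∀ g ∈ ({x, y, u, v, t} : Set R), ∀ m ∈ M, m * g ∈ M := by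
    intro g hg m hm
    induction hm using Submodule.span_induction with
    | zero => simp
    | add a b _ _ ha hb => rw [add_mul]; exact M.add_mem ha hb
    | smul a b _ hb => rw [smul_mul_assoc]; exact M.smul_mem a hb
    | mem b hb =>
      simp only [hs, Set.mem_insert_iff, Set.mem_singleton_iff] at hg hb
      rcases hg with rfl | rfl | rfl | rfl | rfl <;>
      rcases hb with rfl | rfl | rfl | rfl | rfl | rfl | rfl | rfl <;>
      (try simp only [mul_assoc, ← xu, ← xv, uy, vy, vu, uu, vv, tt, tx, ty, tu, tv,
        assoc xu.symm, assoc xv.symm, assoc uy, assoc vy, assoc vu, assoc uu, assoc vv,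
        one_mul, mul_one, mul_zero, zero_mul,
        mul_add, mul_sub, add_mul, sub_mul, mul_neg, neg_zero]) <;>
      (repeat' first
        | assumption
        | apply M.zero_mem
        | apply M.neg_mem
        | apply M.add_mem
        | apply M.sub_mem
        | apply x_mul_mem
        | apply y_mul_mem)
  have hmul (p : R) : ∀ m ∈ M, m * p ∈ M := by
    have hp : p ∈ Algebra.adjoin ℂ ({x, y, u, v, t} : Set R) := hgen ▸ Algebra.mem_top
    induction hp using Algebra.adjoin_induction with
    | mem g hg => exact hstep g hg
    | algebraMap c =>
      intro m hm
      rw [← Algebra.commutes]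
      exact M.smul_mem (algebraMap ℂ A c) hm
    | add a b _ _ ha hb => exact fun m hm => mul_add m a b ▸ M.add_mem (ha m hm) (hb m hm)
    | mul a b _ _ ha hb => exact fun m hm => mul_assoc m a b ▸ hb _ (ha m hm)
  exact Submodule.eq_top_iff'.mpr fun p => one_mul p ▸ hmul p 1 h_one

end Finiteness

theorem adjoin_generators_eq_top : Algebra.adjoin ℂ {hx, hy, hu, hv, ht} = ⊤ := by
  have h := congrArg (Subalgebra.map (RingQuot.mkAlgHom ℂ Hrel))
    (FreeAlgebra.adjoin_range_ι ℂ (Fin 5))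
  rw [AlgHom.map_adjoin, Algebra.map_top,
    (AlgHom.range_eq_top _).mpr (RingQuot.mkAlgHom_surjective ℂ Hrel)] at h
  rw [← h]
  congr 1
  ext z
  simp [Fin.exists_fin_succ, hx, hy, hu, hv, ht, eq_comm]

theorem Hgl_finite : Module.Finite (Algebra.adjoin ℂ {hx, hy}) Hgl := by
  have key := span_monomials_eq_top (x := hx) (y := hy) (u := hu) (v := hv) (t := ht)
    (by simpa [hx, hy, hu, hv, ht] using RingQuot.mkAlgHom_rel ℂ Hrel.xu)
    (by simpa [hx, hy, hu, hv, ht] using RingQuot.mkAlgHom_rel ℂ Hrel.xv)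
    (by simpa [hx, hy, hu, hv, ht] using RingQuot.mkAlgHom_rel ℂ Hrel.yu)
    (by simpa [hx, hy, hu, hv, ht] using RingQuot.mkAlgHom_rel ℂ Hrel.yv)
    (by simpa [hx, hy, hu, hv, ht] using RingQuot.mkAlgHom_rel ℂ Hrel.uu)
    (by simpa [hx, hy, hu, hv, ht] using RingQuot.mkAlgHom_rel ℂ Hrel.vv)
    (by simpa [hx, hy, hu, hv, ht] using RingQuot.mkAlgHom_rel ℂ Hrel.uv)
    (by simpa [hx, hy, hu, hv, ht] using RingQuot.mkAlgHom_rel ℂ Hrel.tt)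
    (by simpa [hx, hy, hu, hv, ht] using RingQuot.mkAlgHom_rel ℂ Hrel.tx)
    (by simpa [hx, hy, hu, hv, ht] using RingQuot.mkAlgHom_rel ℂ Hrel.ty)
    (by simpa [hx, hy, hu, hv, ht] using RingQuot.mkAlgHom_rel ℂ Hrel.tu)
    (by simpa [hx, hy, hu, hv, ht] using RingQuot.mkAlgHom_rel ℂ Hrel.tv)
    adjoin_generators_eq_top
  exact ⟨Submodule.fg_def.mpr ⟨_, Set.toFinite _, key⟩⟩

open scoped IsMulCommutative in
theorem exists_satisfiesStandardIdentity_Hgl :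
    ∃ N, 0 < N ∧ SatisfiesStandardIdentity N Hgl := by
  have hcomm : ∀ a ∈ ({hx, hy} : Set Hgl), ∀ b ∈ ({hx, hy} : Set Hgl), a * b = b * a := by
    have hxy : hx * hy = hy * hx := by
      simpa [hx, hy] using RingQuot.mkAlgHom_rel ℂ Hrel.xy
    rintro a (rfl | rfl) b (rfl | rfl) <;> first | rfl | exact hxy | exact hxy.symm
  have := Algebra.isMulCommutative_adjoin ℂ hcomm
  have := Hgl_finite
  exact SatisfiesStandardIdentity.exists_of_finite (Algebra.adjoin ℂ {hx, hy}) Hgl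

/-- `H(gl(1,1))` satisfies a standard polynomial identity: for some `N > 0`,
`Σ_{σ ∈ S_N} sgn(σ) a_{σ(1)} ⋯ a_{σ(N)} = 0` for all `a₁, …, a_N`. -/
theorem stmt_6 :
    ∃ N : ℕ, 0 < N ∧ ∀ a : Fin N → Hgl,
      ∑ σ : Equiv.Perm (Fin N),
        (Equiv.Perm.sign σ : ℤ) • (List.ofFn fun i => a (σ i)).prod = 0 := by
  exact exists_satisfiesStandardIdentity_Hgl
end
end

section
/- U(gl(1,1)) is not finitely generated as a module over its center Z(U(gl(1,1))). -/
open FreeAlgebra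

noncomputable section

/-- The defining relations of the enveloping algebra `U(gl(1,1))`: generators
`x = ι 0`, `y = ι 1`, `u = ι 2`, `v = ι 3`. -/
inductive Urel : FreeAlgebra ℂ (Fin 4) → FreeAlgebra ℂ (Fin 4) → Prop
  | xy : Urel (ι ℂ 0 * ι ℂ 1) (ι ℂ 1 * ι ℂ 0)
  | xu : Urel (ι ℂ 0 * ι ℂ 2) (ι ℂ 2 * ι ℂ 0)
  | xv : Urel (ι ℂ 0 * ι ℂ 3) (ι ℂ 3 * ι ℂ 0)
  | yu : Urel (ι ℂ 1 * ι ℂ 2 - ι ℂ 2 * ι ℂ 1) (ι ℂ 2)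
  | yv : Urel (ι ℂ 1 * ι ℂ 3 - ι ℂ 3 * ι ℂ 1) (-ι ℂ 3)
  | uu : Urel (ι ℂ 2 * ι ℂ 2) 0
  | vv : Urel (ι ℂ 3 * ι ℂ 3) 0
  | uv : Urel (ι ℂ 2 * ι ℂ 3 + ι ℂ 3 * ι ℂ 2) (ι ℂ 0)

/-- The enveloping algebra `U(gl(1,1))`, i.e. the free algebra modulo the
two-sided ideal generated by the relations. -/
abbrev Ugl : Type := RingQuot Urel

/-- The image of the generator `x` in `U(gl(1,1))`. -/
def ux : Ugl := RingQuot.mkAlgHom ℂ Urel (ι ℂ 0)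
/-- The image of the generator `y` in `U(gl(1,1))`. -/
def uy : Ugl := RingQuot.mkAlgHom ℂ Urel (ι ℂ 1)
/-- The image of the generator `u` in `U(gl(1,1))`. -/
def uu : Ugl := RingQuot.mkAlgHom ℂ Urel (ι ℂ 2)
/-- The image of the generator `v` in `U(gl(1,1))`. -/
def uv : Ugl := RingQuot.mkAlgHom ℂ Urel (ι ℂ 3)

open Polynomial in
/-- The algebra map `U(gl(1,1)) → ℂ[X]` killing all generators but `y`, which it sends to `X`. -/
def Ugl.toPoly : Ugl →ₐ[ℂ] ℂ[X] :=
  RingQuot.liftAlgHom ℂ ⟨FreeAlgebra.lift ℂ ![0, X, 0, 0], by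
    intro a b h
    cases h <;> simp⟩

open Polynomial in
/-- The two-dimensional representation of `U(gl(1,1))` over `ℂ[X]` on which `x` and `v` act
by zero, `y` acts with weights `X + 1` and `X`, and `u` raises the weight. -/
def Ugl.toMatrix : Ugl →ₐ[ℂ] Matrix (Fin 2) (Fin 2) ℂ[X] :=
  RingQuot.liftAlgHom ℂ ⟨FreeAlgebra.lift ℂ ![0, !![X + 1, 0; 0, X], !![0, 1; 0, 0], 0], by
    intro a b h
    cases h <;> simp [← Matrix.ext_iff, Fin.forall_fin_two]⟩

open Polynomial in
theorem Ugl.toMatrix_entries (z : Ugl) :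
    toMatrix z 1 0 = 0 ∧ toMatrix z 1 1 = toPoly z ∧
      toMatrix z 0 0 = (toPoly z).comp (X + 1) := by
  obtain ⟨a, rfl⟩ := RingQuot.mkAlgHom_surjective ℂ Urel z
  induction a using FreeAlgebra.induction with
  | grade0 r => simp [Matrix.algebraMap_matrix_apply]
  | grade1 i =>
    rw [toMatrix, toPoly, RingQuot.liftAlgHom_mkAlgHom_apply, RingQuot.liftAlgHom_mkAlgHom_apply,
      FreeAlgebra.lift_ι_apply, FreeAlgebra.lift_ι_apply]
    revert i
    simp [Fin.forall_fin_succ]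
  | mul a b ha hb => simp_all [Matrix.mul_apply]
  | add a b ha hb => simp_all

open Polynomial in
theorem Polynomial.eq_C_of_comp_X_add_one_eq {R : Type*} [CommRing R] [IsDomain R] [CharZero R]
    {p : R[X]} (hp : p.comp (X + 1) = p) : p = C (p.eval 0) := by
  have h (n : ℕ) : p.eval (n : R) = p.eval 0 := by
    induction n with
    | zero => simp
    | succ n ih =>
      rw [← ih]
      conv_rhs => rw [← hp]
      simp
  refine eq_of_infinite_eval_eq _ _ ((Set.infinite_range_of_injective
    (Nat.cast_injective (R := R))).mono ?_)
  rintro _ ⟨n, rfl⟩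
  simp [h]

open Polynomial in
theorem Ugl.toPoly_eq_C_of_mem_center {z : Ugl} (hz : z ∈ Subring.center Ugl) :
    toPoly z = C ((toPoly z).eval 0) := by
  obtain ⟨-, h11, h00⟩ := toMatrix_entries z
  apply Polynomial.eq_C_of_comp_X_add_one_eq
  have hcomm := congrArg (fun w => toMatrix w 0 1) (Subring.mem_center_iff.mp hz uu)
  have hu : toMatrix uu = !![0, 1; 0, 0] := by simp [toMatrix, uu]
  rw [← h00, ← h11]
  simpa [hu, Matrix.mul_apply] using hcomm.symm

theorem Ugl.toPoly_surjective : Function.Surjective toPoly := fun p =>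
  ⟨Polynomial.aeval uy p, by
    have hy : toPoly uy = Polynomial.X := by simp [toPoly, uy]
    rw [← Polynomial.aeval_algHom_apply, hy, Polynomial.aeval_X_left_apply]⟩

/-- `U(gl(1,1))` is not finitely generated as a module over its center. -/
theorem stmt_7 : ¬ Module.Finite (Subring.center Ugl) Ugl := by
  rintro ⟨S, hS⟩
  refine Polynomial.not_finite (R := ℂ) ⟨(Submodule.fg_def).mpr
    ⟨Ugl.toPoly '' S, S.finite_toSet.image _, eq_top_iff.mpr fun p _ => ?_⟩⟩
  obtain ⟨w, rfl⟩ := Ugl.toPoly_surjective p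
  have hw : w ∈ Submodule.span (Subring.center Ugl) (S : Set Ugl) := hS ▸ Submodule.mem_top
  induction hw using Submodule.span_induction with
  | mem w hw => exact Submodule.subset_span ⟨w, hw, rfl⟩
  | zero => simp
  | add a b _ _ ha hb => rw [map_add]; exact add_mem (ha trivial) (hb trivial)
  | smul z a _ ha =>
    rw [Subring.smul_def, smul_eq_mul, map_mul, Ugl.toPoly_eq_C_of_mem_center z.2,
      ← Polynomial.smul_eq_C_mul]
    exact Submodule.smul_mem _ _ (ha trivial)
end
end

section
/- The center of U(gl(1,1)) is not a Noetherian ring. -/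
open FreeAlgebra

noncomputable section

open Polynomial in
lemma Polynomial.eq_C_of_comp_X_sub_one_eq {p : ℂ[X]} (h : p.comp (X - 1) = p) :
    p = C (p.eval 0) := by
  have hn : ∀ n : ℕ, p.eval (n : ℂ) = p.eval 0 := by
    intro n
    induction n with
    | zero => simp
    | succ n ih =>
      rw [← ih]
      conv_lhs => rw [← h]
      simp [eval_comp]
  rw [← sub_eq_zero]
  refine eq_zero_of_infinite_isRoot _
    ((Set.infinite_range_of_injective (Nat.cast_injective (R := ℂ))).mono ?_)
  rintro _ ⟨n, rfl⟩
  simp [IsRoot, hn n]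

namespace Ugl

lemma uy_mul_uu : uy * uu = uu * (uy + 1) := by
  have h : uy * uu - uu * uy = uu := by
    simpa [uy, uu] using RingQuot.mkAlgHom_rel ℂ Urel.yu
  rw [mul_add, mul_one, add_comm, ← sub_eq_iff_eq_add, h]

lemma add_one_mul_uv : (uy + 1) * uv = uv * uy := by
  have h : uy * uv - uv * uy = -uv := by
    simpa [uy, uv] using RingQuot.mkAlgHom_rel ℂ Urel.yv
  rw [add_mul, one_mul, ← sub_eq_zero, ← sub_eq_zero.2 h]
  abel

lemma uu_mul_uu : uu * uu = 0 := by
  simpa [uu] using RingQuot.mkAlgHom_rel ℂ Urel.uu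

lemma uv_mul_uv : uv * uv = 0 := by
  simpa [uv] using RingQuot.mkAlgHom_rel ℂ Urel.vv

lemma uu_mul_uv_add : uu * uv + uv * uu = ux := by
  simpa [ux, uu, uv] using RingQuot.mkAlgHom_rel ℂ Urel.uv

lemma uy_pow_mul_uu (n : ℕ) : uy ^ n * uu = uu * (uy + 1) ^ n :=
  ((show SemiconjBy uu (uy + 1) uy from uy_mul_uu.symm).pow_right n).eq.symm

lemma add_one_pow_mul_uv (n : ℕ) : (uy + 1) ^ n * uv = uv * uy ^ n :=
  ((show SemiconjBy uv uy (uy + 1) from add_one_mul_uv.symm).pow_right n).eq.symm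

lemma mem_center_of_commute {z : Ugl} (hy : Commute z uy) (hu : Commute z uu)
    (hv : Commute z uv) : z ∈ Subring.center Ugl := by
  rw [Subring.mem_center_iff]
  intro g
  obtain ⟨a, rfl⟩ := RingQuot.mkAlgHom_surjective ℂ Urel g
  suffices h : Commute z (RingQuot.mkAlgHom ℂ Urel a) from h.eq.symm
  induction a using FreeAlgebra.induction with
  | grade0 r =>
    rw [AlgHom.commutes]
    exact Algebra.commute_algebraMap_right r z
  | grade1 i =>
    fin_cases i
    · change Commute z ux
      rw [← uu_mul_uv_add]
      exact (hu.mul_right hv).add_right (hv.mul_right hu)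
    · exact hy
    · exact hu
    · exact hv
  | mul a b ha hb => rw [map_mul]; exact ha.mul_right hb
  | add a b ha hb => rw [map_add]; exact ha.add_right hb

/-- The central element `u v yⁿ + v u (y + 1)ⁿ`. -/
def centralElement (n : ℕ) : Ugl := uu * uv * uy ^ n + uv * uu * (uy + 1) ^ n

lemma centralElement_mem_center (n : ℕ) : centralElement n ∈ Subring.center Ugl := by
  have hy : Commute uy (uu * uv) := by
    rw [commute_iff_eq, ← mul_assoc, uy_mul_uu, mul_assoc, add_one_mul_uv, mul_assoc]
  have hy' : Commute (uy + 1) (uv * uu) := by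
    rw [commute_iff_eq, ← mul_assoc, add_one_mul_uv, mul_assoc, uy_mul_uu, mul_assoc]
  have hy'' : Commute uy (uv * uu) := by
    simpa using hy'.sub_left (Commute.one_left _)
  have hyy : Commute uy (uy + 1) := (Commute.refl uy).add_right (Commute.one_right uy)
  refine mem_center_of_commute ?_ ?_ ?_
  · exact ((hy.mul_right ((Commute.refl uy).pow_right n)).add_right
      (hy''.mul_right (hyy.pow_right n))).symm
  · have h1 : uv * uu * (uy + 1) ^ n * uu = 0 := by
      rw [((hy'.pow_left n).eq).symm, mul_assoc, mul_assoc uv, uu_mul_uu, mul_zero, mul_zero]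
    have h2 : uu * (uu * uv * uy ^ n) = 0 := by
      rw [← mul_assoc, ← mul_assoc, uu_mul_uu, zero_mul, zero_mul]
    rw [commute_iff_eq, centralElement, add_mul, mul_add, h1, h2, add_zero, zero_add,
      mul_assoc, uy_pow_mul_uu]
    simp only [mul_assoc]
  · have h1 : uu * uv * uy ^ n * uv = 0 := by
      rw [((hy.pow_left n).eq).symm, mul_assoc, mul_assoc uu, uv_mul_uv, mul_zero, mul_zero]
    have h2 : uv * (uv * uu * (uy + 1) ^ n) = 0 := by
      rw [← mul_assoc, ← mul_assoc, uv_mul_uv, zero_mul, zero_mul]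
    rw [commute_iff_eq, centralElement, add_mul, mul_add, h1, h2, add_zero, zero_add,
      mul_assoc, add_one_pow_mul_uv]
    simp only [mul_assoc]

open Polynomial TrivSqZeroExt

/-- The `2 × 2` matrices over `ℂ[t][ε]` that are modulo `ε` upper triangular with diagonal of the
form `f(t), f(t - 1)`. -/
def shiftedTriangular : Subalgebra ℂ (Matrix (Fin 2) (Fin 2) (DualNumber ℂ[X])) where
  carrier := {M | (M 1 0).fst = 0 ∧ (M 1 1).fst = (M 0 0).fst.comp (X - 1)}
  mul_mem' := by
    rintro M N ⟨hM, hM'⟩ ⟨hN, hN'⟩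
    simp [Matrix.mul_apply, Fin.sum_univ_two, hM, hM', hN, hN']
  add_mem' := by
    rintro M N ⟨hM, hM'⟩ ⟨hN, hN'⟩
    simp [hM, hM', hN, hN']
  algebraMap_mem' r := by
    simp [Matrix.algebraMap_matrix_apply, TrivSqZeroExt.algebraMap_eq_inl']

/-- The images of the generators `x, y, u, v` under `rep`. -/
def repGen : Fin 4 → shiftedTriangular := ![
  ⟨Matrix.diagonal ![DualNumber.eps, DualNumber.eps], by simp [shiftedTriangular]⟩,
  ⟨Matrix.diagonal ![inl X, inl (X - 1)], by simp [shiftedTriangular]⟩,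
  ⟨!![0, 1; 0, 0], by simp [shiftedTriangular]⟩,
  ⟨!![0, 0; DualNumber.eps, 0], by simp [shiftedTriangular]⟩]

/-- The two-dimensional representation of `U(gl(1,1))` over `ℂ[t][ε]` in which `x` acts
by `ε` and `y` by `diag(t, t - 1)`. -/
def rep : Ugl →ₐ[ℂ] shiftedTriangular :=
  RingQuot.liftAlgHom ℂ ⟨FreeAlgebra.lift ℂ repGen, by
    intro a b h
    apply Subtype.ext
    cases h <;> ext i j : 1 <;> fin_cases i <;> fin_cases j <;>
      simp [repGen, Matrix.mul_apply, Fin.sum_univ_two, Matrix.vecMul_diagonal,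
          mul_comm, mul_sub]⟩

lemma rep_uy : (rep uy : Matrix (Fin 2) (Fin 2) (DualNumber ℂ[X])) =
    Matrix.diagonal ![inl X, inl (X - 1)] := by
  simp [rep, uy, repGen]

lemma rep_uu : (rep uu : Matrix (Fin 2) (Fin 2) (DualNumber ℂ[X])) = !![0, 1; 0, 0] := by
  simp [rep, uu, repGen]

lemma rep_uv : (rep uv : Matrix (Fin 2) (Fin 2) (DualNumber ℂ[X])) =
    !![0, 0; DualNumber.eps, 0] := by
  simp [rep, uv, repGen]

/-- The upper left entry of the matrix of `a` in the representation `rep`. -/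
def topEntry (a : Ugl) : DualNumber ℂ[X] := (rep a).1 0 0

lemma topEntry_add (a b : Ugl) : topEntry (a + b) = topEntry a + topEntry b := by
  simp [topEntry]

lemma topEntry_centralElement (n : ℕ) : topEntry (centralElement n) = inr (X ^ n) := by
  simp [topEntry, centralElement, rep_uy, rep_uu, rep_uv, Matrix.diagonal_pow,
    Matrix.vecMul_diagonal, DualNumber.inr_eq_smul_eps]
  rw [← inl_pow]
  ext <;> simp

lemma rep_of_mem_center {c : Ugl} (hc : c ∈ Subring.center Ugl) :
    (rep c).1 1 0 = 0 ∧ (rep c).1 1 1 = (rep c).1 0 0 := by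
  have h := congrArg (fun a => (rep a).1) (Subring.mem_center_iff.1 hc uu)
  simp only [map_mul, MulMemClass.coe_mul, rep_uu] at h
  have h0 := congrFun (congrFun h 0) 0
  have h1 := congrFun (congrFun h 0) 1
  simp [Matrix.mul_apply, Fin.sum_univ_two] at h0 h1
  exact ⟨h0, h1⟩

lemma topEntry_mul_of_mem_center (a : Ugl) {c : Ugl} (hc : c ∈ Subring.center Ugl) :
    topEntry (a * c) = topEntry a * topEntry c := by
  simp [topEntry, Matrix.mul_apply, Fin.sum_univ_two, (rep_of_mem_center hc).1]

lemma exists_fst_topEntry_eq_C {c : Ugl} (hc : c ∈ Subring.center Ugl) :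
    ∃ r : ℂ, (topEntry c).fst = C r := by
  refine ⟨_, Polynomial.eq_C_of_comp_X_sub_one_eq ?_⟩
  rw [topEntry, ← (rep c).2.2, (rep_of_mem_center hc).2]

lemma topEntry_mem_of_mem_span {n : ℕ} {c : Subring.center Ugl}
    (hc : c ∈ Ideal.span ((fun k => (⟨centralElement k, centralElement_mem_center k⟩ :
      Subring.center Ugl)) '' Set.Iio n)) :
    (topEntry c).fst = 0 ∧ (topEntry c).snd ∈ degreeLT ℂ n := by
  induction hc using Submodule.span_induction with
  | mem c hc =>
    obtain ⟨k, hk, rfl⟩ := hc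
    simpa [topEntry_centralElement, mem_degreeLT] using hk
  | zero => simp [topEntry]
  | add a b _ _ ha hb =>
    rw [Subring.coe_add, topEntry_add]
    simpa [ha.1, hb.1] using Submodule.add_mem _ ha.2 hb.2
  | smul a b _ hb =>
    obtain ⟨r, hr⟩ := exists_fst_topEntry_eq_C a.2
    rw [smul_eq_mul, Subring.coe_mul, topEntry_mul_of_mem_center _ b.2]
    simpa [hb.1, hr, ← smul_eq_C_mul] using Submodule.smul_mem _ r hb.2

end Ugl

/-- The center of `U(gl(1,1))` is not a Noetherian ring. -/
theorem stmt_8 : ¬ IsNoetherianRing (Subring.center Ugl) := by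
  intro h
  let z : ℕ → Subring.center Ugl := fun k =>
    ⟨Ugl.centralElement k, Ugl.centralElement_mem_center k⟩
  obtain ⟨n, hn⟩ := monotone_stabilizes_iff_noetherian.2 h
    ⟨fun n => Ideal.span (z '' Set.Iio n), fun m n hmn =>
      Ideal.span_mono (Set.image_mono (Set.Iio_subset_Iio hmn))⟩
  have hz : z n ∈ Ideal.span (z '' Set.Iio n) := by
    have : Ideal.span (z '' Set.Iio n) = Ideal.span (z '' Set.Iio (n + 1)) :=
      hn (n + 1) n.le_succ
    rw [this]
    exact Ideal.subset_span ⟨n, Nat.lt_succ_self n, rfl⟩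
  have := (Ugl.topEntry_mem_of_mem_span hz).2
  simp [z, Ugl.topEntry_centralElement, Polynomial.mem_degreeLT] at this
end
end

section
/- The center of H(gl(1,1)) is not a Noetherian ring. -/
open FreeAlgebra

noncomputable section

namespace Hgl

open Polynomial

lemma hx_mul_hy : hx * hy = hy * hx := by
  simpa [hx, hy] using RingQuot.mkAlgHom_rel ℂ Hrel.xy

lemma hx_mul_hu : hx * hu = hu * hx := by
  simpa [hx, hu] using RingQuot.mkAlgHom_rel ℂ Hrel.xu

lemma hx_mul_hv : hx * hv = hv * hx := by
  simpa [hx, hv] using RingQuot.mkAlgHom_rel ℂ Hrel.xv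

lemma hy_mul_hu : hy * hu - hu * hy = hu := by
  simpa [hy, hu] using RingQuot.mkAlgHom_rel ℂ Hrel.yu

lemma hy_mul_hv : hy * hv - hv * hy = -hv := by
  simpa [hy, hv] using RingQuot.mkAlgHom_rel ℂ Hrel.yv

lemma hu_mul_hu : hu * hu = 0 := by
  simpa [hu] using RingQuot.mkAlgHom_rel ℂ Hrel.uu

lemma hv_mul_hv : hv * hv = 0 := by
  simpa [hv] using RingQuot.mkAlgHom_rel ℂ Hrel.vv

lemma hu_mul_hv_add : hu * hv + hv * hu = hx := by
  simpa [hu, hv, hx] using RingQuot.mkAlgHom_rel ℂ Hrel.uv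

lemma ht_mul_hx : ht * hx = hx * ht := by
  simpa [ht, hx] using RingQuot.mkAlgHom_rel ℂ Hrel.tx

lemma ht_mul_hy : ht * hy = hy * ht := by
  simpa [ht, hy] using RingQuot.mkAlgHom_rel ℂ Hrel.ty

lemma ht_mul_hu : ht * hu = -(hu * ht) := by
  simpa [ht, hu] using RingQuot.mkAlgHom_rel ℂ Hrel.tu

lemma ht_mul_hv : ht * hv = -(hv * ht) := by
  simpa [ht, hv] using RingQuot.mkAlgHom_rel ℂ Hrel.tv

/-- Induction over `H(gl(1,1))` from scalars and generators. -/
lemma induction {p : Hgl → Prop} (algebraMap : ∀ r : ℂ, p (algebraMap ℂ Hgl r))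
    (hx : p hx) (hy : p hy) (hu : p hu) (hv : p hv) (ht : p ht)
    (add : ∀ a b, p a → p b → p (a + b)) (mul : ∀ a b, p a → p b → p (a * b)) (z : Hgl) :
    p z := by
  obtain ⟨a, rfl⟩ := RingQuot.mkAlgHom_surjective ℂ Hrel z
  induction a using FreeAlgebra.induction with
  | grade0 r => simpa using algebraMap r
  | grade1 i => fin_cases i <;> assumption
  | mul a b ha hb => simpa using mul _ _ ha hb
  | add a b ha hb => simpa using add _ _ ha hb

/-! ### Central elements -/

/-- The element `x yⁿ + ((y - 1)ⁿ - yⁿ) u v`. -/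
def casimir (n : ℕ) : Hgl := hx * hy ^ n + ((hy - 1) ^ n - hy ^ n) * (hu * hv)

lemma semiconjBy_hu_hy : SemiconjBy hu hy (hy - 1) := by
  have := hy_mul_hu
  rw [SemiconjBy, sub_mul, one_mul]
  nth_rw 3 [← this]
  abel

lemma semiconjBy_hv_hy : SemiconjBy hv (hy - 1) hy := by
  have := hy_mul_hv
  rw [SemiconjBy, mul_sub, mul_one, sub_eq_add_neg, ← this]
  abel

lemma hu_mul_hv_mul_hu : hu * hv * hu = hx * hu := by
  rw [← hu_mul_hv_add, add_mul, mul_assoc hv, hu_mul_hu, mul_zero, add_zero]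

lemma hv_mul_hu_mul_hv : hv * (hu * hv) = hx * hv := by
  rw [← hu_mul_hv_add, add_mul, mul_assoc hu hv hv, hv_mul_hv, mul_zero, zero_add, mul_assoc]

lemma commute_hy_hu_mul_hv : Commute hy (hu * hv) := by
  have h' : SemiconjBy (hu * hv) (hy - 1) (hy - 1) := semiconjBy_hu_hy.mul_left semiconjBy_hv_hy
  have h'' := h'.add_right (SemiconjBy.one_right _)
  rw [sub_add_cancel] at h''
  exact h''.symm

lemma commute_hx_casimir (n : ℕ) : Commute hx (casimir n) := by
  have hxy : Commute hx hy := hx_mul_hy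
  have hxu : Commute hx hu := hx_mul_hu
  have hxv : Commute hx hv := hx_mul_hv
  exact ((Commute.refl _).mul_right (hxy.pow_right n)).add_right
    (((((hxy.sub_right (.one_right _)).pow_right n)).sub_right (hxy.pow_right n)).mul_right
      (hxu.mul_right hxv))

lemma commute_hy_casimir (n : ℕ) : Commute hy (casimir n) := by
  have hyx : Commute hy hx := hx_mul_hy.symm
  have hyy : Commute hy hy := .refl _
  exact (hyx.mul_right (hyy.pow_right n)).add_right
    (((((hyy.sub_right (.one_right _)).pow_right n)).sub_right (hyy.pow_right n)).mul_right
      commute_hy_hu_mul_hv)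

lemma commute_ht_casimir (n : ℕ) : Commute ht (casimir n) := by
  have htx : Commute ht hx := ht_mul_hx
  have hty : Commute ht hy := ht_mul_hy
  have htuv : Commute ht (hu * hv) := by
    have neg_mul' (a b : Hgl) : -a * b = -(a * b) := neg_mul a b
    have mul_neg' (a b : Hgl) : a * -b = -(a * b) := mul_neg a b
    have neg_neg' (a : Hgl) : - -a = a := neg_neg a
    rw [Commute, SemiconjBy, ← mul_assoc, ht_mul_hu, neg_mul', mul_assoc, ht_mul_hv, mul_neg',
      neg_neg', mul_assoc]
  exact (htx.mul_right (hty.pow_right n)).add_right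
    (((((hty.sub_right (.one_right _)).pow_right n)).sub_right (hty.pow_right n)).mul_right htuv)

lemma commute_hu_casimir (n : ℕ) : Commute hu (casimir n) := by
  have h1 : hu * hy ^ n = (hy - 1) ^ n * hu := semiconjBy_hu_hy.pow_right n
  have h2 : hu * (hy - 1) ^ n = (hy - 1 - 1) ^ n * hu :=
    (semiconjBy_hu_hy.sub_right (SemiconjBy.one_right hu)).pow_right n
  have hxy : Commute hx hy := hx_mul_hy
  have h3 : hx * hy ^ n = hy ^ n * hx := hxy.pow_right n
  have h4 : hx * (hy - 1) ^ n = (hy - 1) ^ n * hx := (hxy.sub_right (.one_right _)).pow_right n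
  have e1 : hu * casimir n = (hy - 1) ^ n * (hx * hu) := by
    rw [casimir, mul_add, ← mul_assoc, ← hx_mul_hu, mul_assoc, h1, ← mul_assoc, h4, ← mul_assoc,
      mul_sub, h1, h2, ← sub_mul, mul_assoc _ hu, ← mul_assoc hu hu, hu_mul_hu]
    simp [mul_assoc]
  have e2 : casimir n * hu = (hy - 1) ^ n * (hx * hu) := by
    rw [casimir, add_mul, mul_assoc _ (hu * hv), hu_mul_hv_mul_hu, h3, sub_mul, mul_assoc]
    abel
  exact e1.trans e2.symm

lemma commute_hv_casimir (n : ℕ) : Commute hv (casimir n) := by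
  have h1 : hv * (hy - 1) ^ n = hy ^ n * hv := semiconjBy_hv_hy.pow_right n
  have h2 : hv * hy ^ n = (hy + 1) ^ n * hv := by
    have := (semiconjBy_hv_hy.add_right (SemiconjBy.one_right hv)).pow_right n
    rwa [sub_add_cancel] at this
  have hxy : Commute hx hy := hx_mul_hy
  have h3 : hx * hy ^ n = hy ^ n * hx := hxy.pow_right n
  have h4 : hx * (hy + 1) ^ n = (hy + 1) ^ n * hx := (hxy.add_right (.one_right _)).pow_right n
  have e1 : hv * casimir n = hy ^ n * (hx * hv) := by
    rw [casimir, mul_add, ← mul_assoc, ← hx_mul_hv, mul_assoc, h2, ← mul_assoc, h4, ← mul_assoc hv,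
      mul_sub, h1, h2, ← sub_mul, mul_assoc _ hv, hv_mul_hu_mul_hv, sub_mul, mul_assoc]
    abel
  have e2 : casimir n * hv = hy ^ n * (hx * hv) := by
    rw [casimir, add_mul, h3, mul_assoc _ (hu * hv), mul_assoc hu, hv_mul_hv]
    simp [mul_assoc]
  exact e1.trans e2.symm

lemma casimir_mem_center (n : ℕ) : casimir n ∈ Subring.center Hgl := by
  rw [Subring.mem_center_iff]
  intro z
  change Commute z (casimir n)
  exact induction (p := (Commute · (casimir n))) (fun r ↦ Algebra.commute_algebraMap_left r _)
    (commute_hx_casimir n) (commute_hy_casimir n) (commute_hu_casimir n) (commute_hv_casimir n)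
    (commute_ht_casimir n) (fun _ _ ↦ Commute.add_left) (fun _ _ ↦ Commute.mul_left) z

/-! ### Representations -/

section Representations

variable {R S : Type*} [CommRing R] [Algebra ℂ R] [CommRing S] [Algebra ℂ S]

/-- The rank two highest weight representation in which `x` acts by the scalar `a`, and `y`, `t`
act on the highest weight vector by `b`, `e`. -/
def verma (a b e : R) (he : e * e = 1) : Hgl →ₐ[ℂ] Matrix (Fin 2) (Fin 2) R :=
  RingQuot.liftAlgHom ℂ ⟨FreeAlgebra.lift ℂ
    ![!![a, 0; 0, a], !![b, 0; 0, b + 1], !![0, 0; 1, 0], !![0, a; 0, 0], !![e, 0; 0, -e]], by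
      intro p q h
      cases h <;> ext i j <;> fin_cases i <;> fin_cases j <;> simp [he] <;> ring⟩

/-- The one-dimensional representation killing `x`, `u`, `v`, in which `y` and `t` act by `b`
and `e`. -/
def character (b e : R) (he : e * e = 1) : Hgl →ₐ[ℂ] R :=
  RingQuot.liftAlgHom ℂ ⟨FreeAlgebra.lift ℂ ![0, b, 0, 0, e], by
      intro p q h
      cases h <;> simp [he, mul_comm]⟩

variable (a b e : R) (he : e * e = 1)

@[simp] lemma verma_hx : verma a b e he hx = !![a, 0; 0, a] := by simp [verma, hx]
@[simp] lemma verma_hy : verma a b e he hy = !![b, 0; 0, b + 1] := by simp [verma, hy]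
@[simp] lemma verma_hu : verma a b e he hu = !![0, 0; 1, 0] := by simp [verma, hu]
@[simp] lemma verma_hv : verma a b e he hv = !![0, a; 0, 0] := by simp [verma, hv]
@[simp] lemma verma_ht : verma a b e he ht = !![e, 0; 0, -e] := by simp [verma, ht]

@[simp] lemma character_hx : character b e he hx = 0 := by simp [character, hx]
@[simp] lemma character_hy : character b e he hy = b := by simp [character, hy]
@[simp] lemma character_hu : character b e he hu = 0 := by simp [character, hu]
@[simp] lemma character_hv : character b e he hv = 0 := by simp [character, hv]
@[simp] lemma character_ht : character b e he ht = e := by simp [character, ht]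

lemma map_character (f : R →ₐ[ℂ] S) (z : Hgl) :
    f (character b e he z) =
      character (f b) (f e) (by rw [← map_mul, he, map_one]) z := by
  induction z using induction with
  | algebraMap r => simp
  | add p q hp hq => simp [hp, hq]
  | mul p q hp hq => simp [hp, hq]
  | _ => simp

/-- When `x` acts by zero, the representation is triangular with characters on the diagonal. -/
lemma map_verma (f : R →ₐ[ℂ] S) (ha : f a = 0) (z : Hgl) :
    f (verma a b e he z 0 1) = 0 ∧
      f (verma a b e he z 0 0) = character (f b) (f e) (by rw [← map_mul, he, map_one]) z ∧
      f (verma a b e he z 1 1) =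
        character (f b + 1) (-f e) (by rw [neg_mul_neg, ← map_mul, he, map_one]) z := by
  induction z using induction with
  | algebraMap r => simp [Matrix.algebraMap_matrix_apply]
  | add p q hp hq => simp [hp, hq]
  | mul p q hp hq => simp [hp, hq, Matrix.mul_apply]
  | _ => simp [ha]

lemma verma_of_mem_center {z : Hgl} (hz : z ∈ Subring.center Hgl) :
    verma a b e he z 0 1 = 0 ∧ verma a b e he z 0 0 = verma a b e he z 1 1 := by
  have h := congrArg (verma a b e he) (Subring.mem_center_iff.mp hz hu)
  rw [map_mul, map_mul, verma_hu] at h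
  have h00 := congrFun (congrFun h 0) 0
  have h10 := congrFun (congrFun h 1) 0
  simp [Matrix.mul_apply] at h00 h10
  exact ⟨h00.symm, h10⟩

lemma character_of_mem_center {z : Hgl} (hz : z ∈ Subring.center Hgl) :
    character b e he z = character (b + 1) (-e) (by rwa [neg_mul_neg]) z := by
  have h := map_verma 0 b e he (AlgHom.id ℂ R) (map_zero _) z
  have h' := (verma_of_mem_center 0 b e he hz).2
  simp only [AlgHom.coe_id, id_eq] at h
  rw [← h.2.1, ← h.2.2, h']

end Representations

lemma eq_C_of_comp_X_add_two {p : ℂ[X]} (h : p.comp (X + 2) = p) : p = C (p.eval 0) := by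
  have key (n : ℕ) : p.eval (2 * n : ℂ) = p.eval 0 := by
    induction n with
    | zero => simp
    | succ n ih =>
      rw [← ih]
      nth_rw 2 [← h]
      simp [mul_add]
  refine eq_of_infinite_eval_eq _ _ ((Set.infinite_range_of_injective
    (f := fun n : ℕ ↦ (2 * n : ℂ)) fun m n hmn ↦ by simpa using hmn).mono ?_)
  rintro _ ⟨n, rfl⟩
  simpa using key n

lemma character_X_eq_C {z : Hgl} (hz : z ∈ Subring.center Hgl) :
    ∃ c : ℂ, character (X : ℂ[X]) 1 (one_mul 1) z = C c := by
  refine ⟨_, eq_C_of_comp_X_add_two ?_⟩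
  have h1 := character_of_mem_center (X : ℂ[X]) 1 (one_mul 1) hz
  have h2 := character_of_mem_center (X + 1 : ℂ[X]) (-1) (by simp) hz
  have h3 := map_character (X : ℂ[X]) 1 (one_mul 1) (aeval (X + 2 : ℂ[X])) z
  rw [comp_eq_aeval, h3, h1, h2]
  congr 2 <;> simp [add_assoc, one_add_one_eq_two]

/-- The value of a central element on the highest weight vector of the universal Verma module. -/
def centralValue (z : Hgl) : ℂ[X][X] := verma X (C X) 1 (one_mul 1) z 0 0

lemma centralValue_add (z w : Hgl) : centralValue (z + w) = centralValue z + centralValue w := by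
  simp [centralValue]

lemma centralValue_mul {z : Hgl} (hz : z ∈ Subring.center Hgl) (w : Hgl) :
    centralValue (z * w) = centralValue z * centralValue w := by
  simp [centralValue, Matrix.mul_apply,
    (verma_of_mem_center (X : ℂ[X][X]) (C X) 1 (one_mul 1) hz).1]

lemma coeff_zero_centralValue {z : Hgl} (hz : z ∈ Subring.center Hgl) :
    ∃ c : ℂ, (centralValue z).coeff 0 = C c := by
  obtain ⟨c, hc⟩ := character_X_eq_C hz
  refine ⟨c, ?_⟩
  have h := (map_verma (X : ℂ[X][X]) (C X) 1 (one_mul 1)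
    ((aeval (0 : ℂ[X])).restrictScalars ℂ) (by simp) z).2.1
  rw [← hc, centralValue, coeff_zero_eq_aeval_zero]
  simpa using h

lemma centralValue_casimir (n : ℕ) : centralValue (casimir n) = C (X ^ n) * X := by
  have h (c d : ℂ[X][X]) : (!![c, 0; 0, d] : Matrix (Fin 2) (Fin 2) ℂ[X][X]) ^ n =
      !![c ^ n, 0; 0, d ^ n] := by
    have (c d : ℂ[X][X]) : (!![c, 0; 0, d] : Matrix (Fin 2) (Fin 2) ℂ[X][X]) =
      Matrix.diagonal ![c, d] := by ext i j; fin_cases i <;> fin_cases j <;> simp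
    rw [this, this, Matrix.diagonal_pow]
    congr 1; ext i; fin_cases i <;> simp
  simp [centralValue, casimir, h, Matrix.mul_apply, mul_comm]

lemma casimir_notMem_span (n : ℕ) :
    (⟨casimir n, casimir_mem_center n⟩ : Subring.center Hgl) ∉
      Ideal.span ((fun k ↦ (⟨casimir k, casimir_mem_center k⟩ : Subring.center Hgl)) ''
        Set.Iio n) := by
  intro hmem
  have key : ∀ w ∈ Ideal.span ((fun k ↦ (⟨casimir k, casimir_mem_center k⟩ :
      Subring.center Hgl)) '' Set.Iio n),
      (centralValue w).coeff 0 = 0 ∧ ((centralValue w).coeff 1).degree < n := by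
    intro w hw
    induction hw using Submodule.span_induction with
    | mem w hw =>
      obtain ⟨k, hk, rfl⟩ := hw
      have hk' : k < n := hk
      simpa only [centralValue_casimir, coeff_C_mul, coeff_X_zero, coeff_X_one, mul_zero, mul_one,
        degree_X_pow, true_and, Nat.cast_lt] using hk'
    | zero => simp [centralValue]
    | add a b _ _ ha hb =>
      simp only [Subring.coe_add, centralValue_add, coeff_add, ha.1, hb.1, add_zero, true_and]
      exact (degree_add_le _ _).trans_lt (max_lt ha.2 hb.2)
    | smul z w _ hw =>
      obtain ⟨c, hc⟩ := coeff_zero_centralValue z.2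
      simp only [smul_eq_mul, Subring.coe_mul, centralValue_mul z.2, mul_coeff_zero, mul_coeff_one,
        hw.1, hc, mul_zero, add_zero, true_and]
      exact ((C_mul' c _).symm ▸ degree_smul_le c _).trans_lt hw.2
  have h := (key _ hmem).2
  simp only [centralValue_casimir, coeff_C_mul, coeff_X_one, mul_one, degree_X_pow,
    lt_self_iff_false] at h

end Hgl

/-- The center of `H(gl(1,1))` is not a Noetherian ring. -/
theorem stmt_9 : ¬ IsNoetherianRing (Subring.center Hgl) := by
  intro hN
  obtain ⟨n, hn⟩ := monotone_stabilizes_iff_noetherian.mpr hN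
    ⟨fun n ↦ Ideal.span ((fun k ↦ (⟨Hgl.casimir k, Hgl.casimir_mem_center k⟩ :
      Subring.center Hgl)) '' Set.Iio n),
      fun _ _ h ↦ Ideal.span_mono (Set.image_mono (Set.Iio_subset_Iio h))⟩
  refine Hgl.casimir_notMem_span n ?_
  have := hn (n + 1) n.le_succ
  change Ideal.span _ = Ideal.span _ at this
  rw [this]
  exact Ideal.subset_span ⟨n, Nat.lt_succ_self n, rfl⟩
end
end

section
/- In the commutative polynomial ring ℂ[X,Y], the ℂ-subalgebra generated by the set {Xⁿ − Yⁿ : n a positive integer} equals the subalgebra consisting of all polynomials f such that f(a,a) = f(0,0) for every a ∈ ℂ (the polynomials constant on the diagonal X = Y). -/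
open MvPolynomial

/-- Newton's identity relating the differences `xⁿ - yⁿ` to the products `(x - y) xⁿ`. -/
lemma succ_mul_sub_mul_pow {R : Type*} [CommRing R] (x y : R) (n : ℕ) :
    ((n : R) + 1) * ((x - y) * x ^ n) = x ^ (n + 1) - y ^ (n + 1) +
      ∑ j ∈ Finset.range n, (x ^ (n - j) - y ^ (n - j)) * ((x - y) * x ^ j) := by
  induction n with
  | zero => simp
  | succ n ih =>
    have h : ∑ j ∈ Finset.range n, (x ^ (n - j) - y ^ (n - j)) * ((x - y) * x ^ (j + 1)) =
        x * ∑ j ∈ Finset.range n, (x ^ (n - j) - y ^ (n - j)) * ((x - y) * x ^ j) := by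
      rw [Finset.mul_sum]
      exact Finset.sum_congr rfl fun j _ => by ring
    rw [Finset.sum_range_succ']
    simp only [Nat.add_sub_add_right, Nat.sub_zero, pow_zero, h]
    push_cast
    linear_combination x * ih

section

variable {K R : Type*} [Field K] [CharZero K] [CommRing R] [Algebra K R]
  {A : Subalgebra K R} {x y : R}

lemma sub_mul_pow_mem (hA : ∀ n, 0 < n → x ^ n - y ^ n ∈ A) (n : ℕ) :
    (x - y) * x ^ n ∈ A := by
  induction n using Nat.strong_induction_on with
  | _ n ih =>
    have h : ((n : R) + 1) * ((x - y) * x ^ n) ∈ A := by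
      rw [succ_mul_sub_mul_pow]
      refine add_mem (hA _ n.succ_pos) (sum_mem fun j hj => ?_)
      have hj := Finset.mem_range.mp hj
      exact mul_mem (hA _ (Nat.sub_pos_of_lt hj)) (ih j hj)
    have hn : (n : K) + 1 ≠ 0 := n.cast_add_one_ne_zero
    have h' : ((n : K) + 1) • ((x - y) * x ^ n) ∈ A := by
      simpa [Algebra.smul_def] using h
    simpa [smul_smul, hn] using A.smul_mem h' ((n : K) + 1)⁻¹

lemma sub_mul_pow_mul_pow_mem (hA : ∀ n, 0 < n → x ^ n - y ^ n ∈ A) (a b : ℕ) :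
    (x - y) * (x ^ a * y ^ b) ∈ A := by
  induction b generalizing a with
  | zero => simpa using sub_mul_pow_mem hA a
  | succ b ih =>
    have hA' : ∀ n, 0 < n → y ^ n - x ^ n ∈ A := fun n hn => by
      simpa using neg_mem (hA n hn)
    have h := add_mem (ih (a + 1)) (mul_mem (sub_mul_pow_mem hA a) (sub_mul_pow_mem hA' b))
    convert h using 1
    ring

end

lemma X_sub_X_mul_mem {K : Type*} [Field K] [CharZero K]
    {A : Subalgebra K (MvPolynomial (Fin 2) K)}
    (hA : ∀ n, 0 < n → (X 0 ^ n - X 1 ^ n : MvPolynomial (Fin 2) K) ∈ A)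
    (g : MvPolynomial (Fin 2) K) : (X 0 - X 1) * g ∈ A := by
  induction g using MvPolynomial.induction_on' with
  | monomial s c =>
    have h := A.smul_mem (sub_mul_pow_mul_pow_mem hA (s 0) (s 1)) c
    rw [← mul_smul_comm] at h
    convert h using 2
    rw [monomial_eq, Finsupp.prod_fintype _ _ (fun _ => pow_zero _), Fin.prod_univ_two,
      smul_eq_C_mul]
  | add p q hp hq =>
    rw [mul_add]
    exact add_mem hp hq

lemma X_sub_X_dvd_sub_aeval_diagonal {R : Type*} [CommRing R] (f : MvPolynomial (Fin 2) R) :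
    (X 0 - X 1 : MvPolynomial (Fin 2) R) ∣ f - aeval ![X 0, X 0] f := by
  induction f using MvPolynomial.induction_on with
  | C c => simp [algebraMap_eq]
  | add p q hp hq =>
    rw [map_add, add_sub_add_comm]
    exact dvd_add hp hq
  | mul_X p i hp =>
    have hi : (X 0 - X 1 : MvPolynomial (Fin 2) R) ∣ X i - X 0 := by
      fin_cases i
      · simp
      · exact ⟨-1, by simp⟩
    have h := dvd_add (hp.mul_right (X i)) (hi.mul_left (aeval ![X 0, X 0] p))
    convert h using 1
    have hX : aeval ![X 0, X 0] (X i : MvPolynomial (Fin 2) R) =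
        (X 0 : MvPolynomial (Fin 2) R) := by
      fin_cases i <;> simp
    rw [map_mul, hX]
    ring

/-- In `ℂ[X,Y]` the subalgebra generated by `{Xⁿ - Yⁿ : n ≥ 1}` is exactly the
subalgebra of polynomials constant on the diagonal `X = Y`. -/
theorem stmt_15 :
    ∀ f : MvPolynomial (Fin 2) ℂ,
      f ∈ Algebra.adjoin ℂ
          {g : MvPolynomial (Fin 2) ℂ | ∃ n : ℕ, 0 < n ∧ g = X 0 ^ n - X 1 ^ n}
        ↔ ∀ a : ℂ, eval ![a, a] f = eval ![0, 0] f := by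
  intro f
  constructor
  · intro hf a
    induction hf using Algebra.adjoin_induction with
    | mem g hg =>
      obtain ⟨n, -, rfl⟩ := hg
      simp
    | algebraMap r => simp [algebraMap_eq]
    | add p q _ _ hp hq => simp only [map_add, hp, hq]
    | mul p q _ _ hp hq => simp only [map_mul, hp, hq]
  · intro hf
    have hdiag : aeval ![X 0, X 0] f =
        (C (eval ![0, 0] f) : MvPolynomial (Fin 2) ℂ) := by
      refine MvPolynomial.funext fun v => ?_
      have h : (aeval v).comp (aeval ![X 0, X 0]) =
          (aeval ![v 0, v 0] : MvPolynomial (Fin 2) ℂ →ₐ[ℂ] ℂ) := by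
        ext i
        fin_cases i <;> simp
      rw [eval_C, ← hf (v 0)]
      simpa [aeval_eq_eval] using DFunLike.congr_fun h f
    obtain ⟨g, hg⟩ := X_sub_X_dvd_sub_aeval_diagonal f
    rw [sub_eq_iff_eq_add.mp hg, hdiag]
    refine add_mem (X_sub_X_mul_mem (fun n hn => Algebra.subset_adjoin ?_) g)
      (Subalgebra.algebraMap_mem _ _)
    exact ⟨n, hn, rfl⟩
end

section
/- The subalgebra S of ℂ[X,Y] consisting of all polynomials f such that f(a,a) = f(0,0) for every a ∈ ℂ (the polynomials constant on the diagonal X = Y) is not a Noetherian ring. -/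
open MvPolynomial

/-- The subalgebra of `ℂ[X,Y]` of polynomials constant on the diagonal
`X = Y`. -/
noncomputable def diagConstSubalgebra : Subalgebra ℂ (MvPolynomial (Fin 2) ℂ) where
  carrier := {f | ∀ a : ℂ, eval ![a, a] f = eval ![0, 0] f}
  mul_mem' := by
    intro f g hf hg a
    simp only [Set.mem_setOf_eq] at hf hg ⊢
    simp [hf a, hg a]
  add_mem' := by
    intro f g hf hg a
    simp only [Set.mem_setOf_eq] at hf hg ⊢
    simp [hf a, hg a]
  algebraMap_mem' := by
    intro c a
    simp

theorem X_sub_X_mul_X_pow_mem_diagConstSubalgebra (n : ℕ) :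
    (X 0 - X 1) * X 0 ^ n ∈ diagConstSubalgebra := by
  change ∀ a : ℂ, eval ![a, a] _ = eval ![0, 0] _
  simp

/-- The element `(X - Y) * X ^ n` of `diagConstSubalgebra`. -/
noncomputable def diagConstSubalgebra.gen (n : ℕ) : diagConstSubalgebra :=
  ⟨(X 0 - X 1) * X 0 ^ n, X_sub_X_mul_X_pow_mem_diagConstSubalgebra n⟩

theorem diagConstSubalgebra.gen_notMem_span (n : ℕ) :
    gen n ∉ Ideal.span (gen '' (Finset.range n : Set ℕ)) := by
  intro h
  obtain ⟨c, hc⟩ := (Submodule.mem_span_image_finset_iff_exists_fun' _).1 h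
  have hne : (X 0 - X 1 : MvPolynomial (Fin 2) ℂ) ≠ 0 := by
    intro h0
    simpa using congrArg (eval ![1, 0]) h0
  have hX : ∑ i ∈ Finset.range n, (c i : MvPolynomial (Fin 2) ℂ) * X 0 ^ i = X 0 ^ n := by
    apply mul_left_cancel₀ hne
    have := congrArg (Subtype.val : diagConstSubalgebra → MvPolynomial (Fin 2) ℂ) hc
    simp only [AddSubmonoidClass.coe_finsetSum, smul_eq_mul, MulMemClass.coe_mul, gen] at this
    rw [← this, Finset.mul_sum]
    exact Finset.sum_congr rfl fun i _ ↦ by ring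
  let q : Polynomial ℂ :=
    ∑ i ∈ Finset.range n, Polynomial.monomial i (eval ![0, 0] (c i : MvPolynomial (Fin 2) ℂ))
  have hq : q = Polynomial.X ^ n := by
    refine Polynomial.funext fun a ↦ ?_
    have := congrArg (eval ![a, a]) hX
    simp only [map_sum, map_mul, map_pow, eval_X, Matrix.cons_val_zero] at this
    simp only [q, Polynomial.eval_finsetSum, Polynomial.eval_monomial, Polynomial.eval_pow,
      Polynomial.eval_X]
    rw [← this]
    exact Finset.sum_congr rfl fun i _ ↦ by rw [(c i).2 a]
  have := congrArg (Polynomial.coeff · n) hq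
  simp [q, Polynomial.finsetSum_coeff, Polynomial.coeff_monomial] at this

/-- The subalgebra of `ℂ[X,Y]` of polynomials constant on the diagonal is not
a Noetherian ring. -/
theorem stmt_16 : ¬ IsNoetherianRing diagConstSubalgebra := by
  intro _
  obtain ⟨n, hn⟩ := monotone_stabilizes_iff_noetherian.2 ‹_›
    (⟨fun n ↦ Ideal.span (diagConstSubalgebra.gen '' (Finset.range n : Set ℕ)), fun m n h ↦
      Ideal.span_mono (Set.image_mono (by simpa using h))⟩ : ℕ →o Ideal diagConstSubalgebra)
  apply diagConstSubalgebra.gen_notMem_span n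
  have h : Ideal.span (diagConstSubalgebra.gen '' (Finset.range n : Set ℕ)) =
      Ideal.span (diagConstSubalgebra.gen '' (Finset.range (n + 1) : Set ℕ)) := hn _ n.le_succ
  rw [h]
  exact Ideal.subset_span ⟨n, by simp, rfl⟩
end

section
/- H(gl(1,1)) is both left Noetherian and right Noetherian as a ring. -/
open FreeAlgebra

noncomputable section

/-- A ring is left Noetherian if it is generated by a set `G`, and some finite set `W` spans over a
left Noetherian subalgebra a submodule containing `1` and stable under right multiplication
by `G`. -/
theorem isNoetherianRing_of_span_mul_mem {k R : Type*} [CommRing k] [Ring R] [Algebra k R]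
    (B : Subalgebra k R) [IsNoetherianRing B] {W G : Set R} (hW : W.Finite)
    (hG : Algebra.adjoin k G = ⊤) (one_mem : 1 ∈ Submodule.span B W)
    (mul_mem : ∀ g ∈ G, ∀ w ∈ W, w * g ∈ Submodule.span B W) :
    IsNoetherianRing R := by
  have key : ∀ a : R, ∀ m ∈ Submodule.span B W, m * a ∈ Submodule.span B W := by
    intro a
    have ha : a ∈ Algebra.adjoin k G := hG ▸ Algebra.mem_top
    induction ha using Algebra.adjoin_induction with
    | mem g hg =>
      intro m hm
      induction hm using Submodule.span_induction with
      | mem w hw => exact mul_mem g hg w hw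
      | zero => simp
      | add p q _ _ hp hq => simpa only [add_mul] using add_mem hp hq
      | smul b p _ hp => simpa only [smul_mul_assoc] using Submodule.smul_mem _ b hp
    | algebraMap r =>
      intro m hm
      rw [← Algebra.commutes, ← Algebra.smul_def, ← algebraMap_smul B r m]
      exact Submodule.smul_mem _ _ hm
    | add p q _ _ hp hq => intro m hm; simpa only [mul_add] using add_mem (hp m hm) (hq m hm)
    | mul p q _ _ hp hq => intro m hm; simpa only [mul_assoc] using hq _ (hp m hm)
  have top : Submodule.span B W = ⊤ :=
    Submodule.eq_top_iff'.2 fun a => by simpa using key a 1 one_mem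
  have : Module.Finite B R := ⟨Submodule.fg_def.2 ⟨W, hW, top⟩⟩
  exact isNoetherian_of_tower B inferInstance

open scoped IsMulCommutative in
/-- The subalgebra generated by two commuting elements is Noetherian. -/
theorem isNoetherianRing_adjoin_pair {k R : Type*} [CommRing k] [IsNoetherianRing k] [Ring R]
    [Algebra k R] {x y : R} (hxy : x * y = y * x) :
    IsNoetherianRing (Algebra.adjoin k ({x, y} : Set R)) := by
  have : IsMulCommutative (Algebra.adjoin k ({x, y} : Set R)) :=
    Algebra.isMulCommutative_adjoin k (by
      rintro a (rfl | rfl) b (rfl | rfl) <;> first | rfl | exact hxy | exact hxy.symm)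
  have : Algebra.FiniteType k (Algebra.adjoin k ({x, y} : Set R)) :=
    (Subalgebra.fg_iff_finiteType _).1 (Subalgebra.fg_def.2 ⟨_, Set.toFinite _, rfl⟩)
  exact Algebra.FiniteType.isNoetherianRing k (Algebra.adjoin k ({x, y} : Set R))

set_option maxHeartbeats 800000 in
/-- Any algebra generated by elements satisfying the relations of `H(gl(1,1))` is left
Noetherian. -/
theorem isNoetherianRing_of_gl_relations {k R : Type*} [CommRing k] [IsNoetherianRing k] [Ring R]
    [Algebra k R] {x y u v t : R} (xy : x * y = y * x) (xu : x * u = u * x) (xv : x * v = v * x)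
    (yu : y * u - u * y = u) (yv : y * v - v * y = -v) (uu : u * u = 0) (vv : v * v = 0)
    (uv : u * v + v * u = x) (tt : t * t = 1) (tx : t * x = x * t) (ty : t * y = y * t)
    (tu : t * u = -(u * t)) (tv : t * v = -(v * t))
    (gen : Algebra.adjoin k ({x, y, u, v, t} : Set R) = ⊤) : IsNoetherianRing R := by
  have := isNoetherianRing_adjoin_pair (k := k) xy
  let B := Algebra.adjoin k ({x, y} : Set R)
  let W : Set R := {1, u, v, u * v, t, u * t, v * t, u * (v * t)}
  have hW : ∀ w ∈ W, w ∈ Submodule.span B W := fun w hw => Submodule.subset_span hw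
  have hx : ∀ m ∈ Submodule.span B W, x * m ∈ Submodule.span B W := fun m hm =>
    Submodule.smul_mem _ (⟨x, Algebra.subset_adjoin (by simp)⟩ : B) hm
  have hy : ∀ m ∈ Submodule.span B W, y * m ∈ Submodule.span B W := fun m hm =>
    Submodule.smul_mem _ (⟨y, Algebra.subset_adjoin (by simp)⟩ : B) hm
  have hx1 : x ∈ Submodule.span B W := by simpa using hx 1 (hW 1 (by simp [W]))
  have hy1 : y ∈ Submodule.span B W := by simpa using hy 1 (hW 1 (by simp [W]))
  have uy : u * y = y * u - u := by rw [eq_sub_iff_add_eq, ← eq_sub_iff_add_eq', yu]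
  have vy : v * y = y * v + v := by rw [← sub_eq_iff_eq_add', ← neg_sub, yv, neg_neg]
  have vu : v * u = x - u * v := eq_sub_of_add_eq' uv
  have assoc : ∀ {a b c : R}, a * b = c → ∀ m, a * (b * m) = c * m := by
    rintro a b _ rfl m; rw [mul_assoc]
  refine isNoetherianRing_of_span_mul_mem B (W := W) (Set.toFinite W) gen (hW 1 (by simp [W])) ?_
  -- Rewrite every product with `x`, `y` on the left, followed by an element of `W`.
  rintro g (rfl | rfl | rfl | rfl | rfl) w (rfl | rfl | rfl | rfl | rfl | rfl | rfl | rfl) <;>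
  (try simp only [mul_assoc, one_mul, mul_one, mul_zero, zero_mul, mul_neg, add_mul, mul_add,
    sub_mul, mul_sub, ← xu, ← xv, uy, vy, vu, uu, vv, tt, tx, ty, tu, tv, assoc xu.symm,
    assoc xv.symm, assoc uy, assoc vy, assoc vu, assoc uu, assoc vv]) <;>
  repeat' first
    | exact zero_mem _
    | exact hx1
    | exact hy1
    | apply add_mem
    | apply sub_mem
    | apply neg_mem
    | apply hx
    | apply hy
    | (apply hW; simp only [W, Set.mem_insert_iff, Set.mem_singleton_iff, true_or, or_true])

/-- The images of the five generators generate `H(gl(1,1))`. -/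
theorem Hgl.adjoin_generators : Algebra.adjoin ℂ ({hx, hy, hu, hv, ht} : Set Hgl) = ⊤ := by
  have h := congrArg (Subalgebra.map (RingQuot.mkAlgHom ℂ Hrel))
    (FreeAlgebra.adjoin_range_ι ℂ (Fin 5))
  rw [AlgHom.map_adjoin, Algebra.map_top,
    (AlgHom.range_eq_top _).2 (RingQuot.mkAlgHom_surjective ℂ Hrel)] at h
  rw [← h]
  congr 1
  ext a
  simp [Fin.exists_fin_succ, hx, hy, hu, hv, ht, eq_comm]

/-- `H(gl(1,1))` is left Noetherian and right Noetherian. -/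
theorem stmt_19 : IsNoetherianRing Hgl ∧ IsNoetherianRing Hglᵐᵒᵖ := by
  have rel {a b} (h : Hrel a b) := RingQuot.mkAlgHom_rel ℂ h
  have xy : hx * hy = hy * hx := by
    simpa only [map_mul, hx, hy] using rel .xy
  have xu : hx * hu = hu * hx := by
    simpa only [map_mul, hx, hu] using rel .xu
  have xv : hx * hv = hv * hx := by
    simpa only [map_mul, hx, hv] using rel .xv
  have yu : hy * hu - hu * hy = hu := by
    simpa only [map_mul, map_sub, hy, hu] using rel .yu
  have yv : hy * hv - hv * hy = -hv := by
    simpa only [map_mul, map_sub, map_neg, hy, hv] using rel .yv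
  have uu : hu * hu = 0 := by
    simpa only [map_mul, map_zero, hu] using rel .uu
  have vv : hv * hv = 0 := by
    simpa only [map_mul, map_zero, hv] using rel .vv
  have uv : hu * hv + hv * hu = hx := by
    simpa only [map_mul, map_add, hu, hv, hx] using rel .uv
  have tt : ht * ht = 1 := by
    simpa only [map_mul, map_one, ht] using rel .tt
  have tx : ht * hx = hx * ht := by
    simpa only [map_mul, ht, hx] using rel .tx
  have ty : ht * hy = hy * ht := by
    simpa only [map_mul, ht, hy] using rel .ty
  have tu : ht * hu = -(hu * ht) := by
    simpa only [map_mul, map_neg, ht, hu] using rel .tu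
  have tv : ht * hv = -(hv * ht) := by
    simpa only [map_mul, map_neg, ht, hv] using rel .tv
  refine ⟨isNoetherianRing_of_gl_relations xy xu xv yu yv uu vv uv tt tx ty tu tv
    Hgl.adjoin_generators, ?_⟩
  -- In the opposite algebra the same relations hold with `u` and `v` interchanged.
  refine isNoetherianRing_of_gl_relations (k := ℂ) (x := .op hx) (y := .op hy) (u := .op hv)
    (v := .op hu) (t := .op ht) ?_ ?_ ?_ ?_ ?_ ?_ ?_ ?_ ?_ ?_ ?_ ?_ ?_ ?_ <;>
  try apply MulOpposite.unop_injective
  · exact xy.symm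
  · exact xv.symm
  · exact xu.symm
  · simpa using congrArg Neg.neg yv
  · simpa using congrArg Neg.neg yu
  · exact vv
  · exact uu
  · exact uv
  · exact tt
  · exact tx.symm
  · exact ty.symm
  · simpa using congrArg Neg.neg tv.symm
  · simpa using congrArg Neg.neg tu.symm
  · have h := Subalgebra.op_adjoin (R := ℂ) ({hx, hy, hu, hv, ht} : Set Hgl)
    rw [Hgl.adjoin_generators, Subalgebra.op_top] at h
    rw [h]
    congr 1
    ext a
    simp [← MulOpposite.unop_inj]
    tauto
end
end
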